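/- For every integer m ≥ 0 and every integer n ≥ 1, the two inequalities N(≤ m, n) ≥ M(≤ m, n) and M(≤ m, n) ≥ N(≤ m−1, n) hold. -/

import Mathlib

open scoped BigOperators

namespace RankCrank

/-- The `i`-th largest part of a partition (1-indexed); `0` if `i` exceeds
the number of parts. -/
def part {n : ℕ} (l : n.Partition) (i : ℕ) : ℕ :=
  ((l.parts.sort (· ≤ ·)).reverse).getD (i - 1) 0

/-- The rank of a partition: largest part minus number of parts. -/
def rank {n : ℕ} (l : n.Partition) : ℤ :=
  (part l 1 : ℤ) - l.parts.card

/-- The crank of a partition: the largest part if there are no parts equal to 1,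
otherwise the number of parts larger than the number of 1's minus the number of 1's. -/
def crank {n : ℕ} (l : n.Partition) : ℤ :=
  if l.parts.count 1 = 0 then (part l 1 : ℤ)
  else ((l.parts.filter (fun x => l.parts.count 1 < x)).card : ℤ) - l.parts.count 1

/-- `N m n` is the number of partitions of `n` with rank `m`. -/
noncomputable def N (m : ℤ) (n : ℕ) : ℕ :=
  Nat.card {l : n.Partition // rank l = m}

/-- `M m n` is the number of partitions of `n` with crank `m` for `n ≠ 1`, with the
usual convention for `n = 1`. -/
noncomputable def M (m : ℤ) (n : ℕ) : ℤ :=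
  if n = 1 then (if m = 0 then -1 else if m = 1 ∨ m = -1 then 1 else 0)
  else (Nat.card {l : n.Partition // crank l = m} : ℤ)

/-- `Nle m n = N(≤ m, n) = ∑_{r ≤ m} N(r,n)`; since `N(r,n) = 0` for `r < -n`,
the sum may be taken over `-n ≤ r ≤ m`. -/
noncomputable def Nle (m : ℤ) (n : ℕ) : ℤ :=
  ∑ r ∈ Finset.Icc (-(n : ℤ)) m, (N r n : ℤ)

/-- `Mle m n = M(≤ m, n) = ∑_{r ≤ m} M(r,n)`; since `M(r,n) = 0` for `r < -n`,
the sum may be taken over `-n ≤ r ≤ m`. -/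
noncomputable def Mle (m : ℤ) (n : ℕ) : ℤ :=
  ∑ r ∈ Finset.Icc (-(n : ℤ)) m, M r n

/-- The number of partitions of `n`. -/
noncomputable def p (n : ℕ) : ℕ := Nat.card n.Partition

/-- `ospt n = ∑_{m ≥ 0} m M(m,n) - ∑_{m ≥ 0} m N(m,n)`; since ranks and cranks of
partitions of `n` are at most `n`, the sums may be taken over `0 ≤ m ≤ n`. -/
noncomputable def ospt (n : ℕ) : ℤ :=
  (∑ m ∈ Finset.Icc (0 : ℤ) (n : ℤ), m * M m n) -
    (∑ m ∈ Finset.Icc (0 : ℤ) (n : ℤ), m * (N m n : ℤ))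

/-- The rank-set of a partition `λ`:  `{j - λ_{j+1} : 0 ≤ j ≤ ℓ-1} ∪ {j : j ≥ ℓ}`
(note `part l (j+1) = 0` for `j ≥ ℓ`). -/
def rankSet {n : ℕ} (l : n.Partition) : Set ℤ :=
  {x | ∃ j : ℕ, x = (j : ℤ) - (part l (j + 1) : ℤ)}

/-- `q m n` is the number of partitions of `n` whose rank-set contains `m`. -/
noncomputable def q (m : ℤ) (n : ℕ) : ℕ :=
  Nat.card {l : n.Partition // m ∈ rankSet l}

/-- `prank m n` is the number of partitions of `n` with rank at least `m`. -/
noncomputable def prank (m : ℤ) (n : ℕ) : ℕ :=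
  Nat.card {l : n.Partition // m ≤ rank l}

/-- `jm m l` is the number of columns of the `m`-Durfee rectangle of `l`: the largest
`j ≥ 0` with `λ_{m+j} ≥ j`. -/
noncomputable def jm {n : ℕ} (m : ℕ) (l : n.Partition) : ℕ :=
  sSup {j : ℕ | j ≤ part l (m + j)}

/-- The total number of smallest parts in all partitions of `n`. -/
def spt (n : ℕ) : ℕ :=
  ∑ l : n.Partition, l.parts.count ((l.parts.sort (· ≤ ·)).headD 0)

/-- A bijection `τ` on partitions of `n` nearly preserves the rank–crank
distribution if `crank λ - rank (τ λ)` is `0` when `crank λ = 0`, is `0` or `1`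
when `crank λ > 0`, and is `0` or `-1` when `crank λ < 0`. -/
def NearlyPreserves {n : ℕ} (τ : n.Partition ≃ n.Partition) : Prop :=
  ∀ l : n.Partition,
    (crank l = 0 → crank l - rank (τ l) = 0) ∧
    (0 < crank l → crank l - rank (τ l) = 0 ∨ crank l - rank (τ l) = 1) ∧
    (crank l < 0 → crank l - rank (τ l) = 0 ∨ crank l - rank (τ l) = -1)

end RankCrank

namespace QSeries

open PowerSeries Finset RankCrank

/-- The Gaussian binomial coefficient as a power series. -/
noncomputable def gb : ℕ → ℕ → ℤ⟦X⟧
  | _, 0 => 1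
  | 0, _ + 1 => 0
  | n + 1, k + 1 => gb n k + X ^ (k + 1) * gb n (k + 1)

@[simp] lemma gb_zero_right (n : ℕ) : gb n 0 = 1 := by cases n <;> rfl

@[simp] lemma gb_zero_succ (k : ℕ) : gb 0 (k + 1) = 0 := rfl

lemma gb_succ_succ (n k : ℕ) :
    gb (n + 1) (k + 1) = gb n k + X ^ (k + 1) * gb n (k + 1) := rfl

lemma gb_eq_zero {n k : ℕ} (h : n < k) : gb n k = 0 := by
  induction n generalizing k with
  | zero => obtain ⟨k, rfl⟩ := Nat.exists_eq_succ_of_ne_zero h.ne'; rfl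
  | succ n ih =>
    obtain ⟨k, rfl⟩ := Nat.exists_eq_succ_of_ne_zero (Nat.ne_zero_of_lt h)
    rw [Nat.succ_eq_add_one, gb_succ_succ, ih (by omega), ih (by omega)]
    simp

lemma gb_self (n : ℕ) : gb n n = 1 := by
  induction n with
  | zero => rfl
  | succ n ih => rw [gb_succ_succ, ih, gb_eq_zero (Nat.lt_succ_self n)]; simp

lemma gb_succ_mul (n k : ℕ) :
    (1 - X ^ (k + 1)) * gb (n + 1) (k + 1) = (1 - X ^ (n + 1)) * gb n k := by
  induction n generalizing k with
  | zero => cases k <;> simp [gb_succ_succ]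
  | succ n ih =>
    cases k with
    | zero =>
      have h1 := ih 0
      simp only [gb_succ_succ (n + 1), gb_zero_right, zero_add, mul_one] at h1 ⊢
      linear_combination X * h1
    | succ k =>
      rw [gb_succ_succ (n + 1)]
      linear_combination X ^ (k + 2) * ih (k + 1) + X * ih k -
        X * (1 - X ^ (n + 1)) * gb_succ_succ n k

lemma gb_succ_succ' {n k : ℕ} (h : k ≤ n) :
    gb (n + 1) (k + 1) = X ^ (n - k) * gb n k + gb n (k + 1) := by
  induction n generalizing k with
  | zero =>
    obtain rfl : k = 0 := by omega
    simp [gb_succ_succ]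
  | succ n ih =>
    cases k with
    | zero =>
      have h1 := ih (Nat.zero_le n)
      have h2 := gb_succ_succ n 0
      rw [gb_succ_succ]
      simp only [gb_zero_right, Nat.sub_zero, zero_add, mul_one] at *
      linear_combination X * h1 - h2
    | succ k =>
      rcases eq_or_lt_of_le h with h' | h'
      · obtain rfl : k = n := by omega
        rw [gb_self, gb_self, gb_eq_zero (Nat.lt_succ_self _)]
        simp
      have h1 := ih (k := k) (by omega)
      have h2 := ih (k := k + 1) (by omega)
      have h3 := gb_succ_succ n k
      have h4 := gb_succ_succ n (k + 1)
      obtain ⟨d, rfl⟩ : ∃ d, n = k + 1 + d := ⟨n - (k + 1), by omega⟩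
      rw [show k + 1 + d - k = d + 1 by omega] at h1
      rw [show k + 1 + d - (k + 1) = d by omega] at h2
      rw [gb_succ_succ, show k + 1 + d + 1 - (k + 1) = d + 1 by omega]
      linear_combination (1 - X ^ (d + 1)) * h1 + X ^ (d + 1) * (h1 - h3) + X ^ (k + 2) * h2 - h4

lemma gb_mul_succ {n k : ℕ} (h : k ≤ n) :
    (1 - X ^ (k + 1)) * gb n (k + 1) = (1 - X ^ (n - k)) * gb n k := by
  have h1 := gb_succ_mul n k
  have h2 := gb_succ_succ' h
  have h3 := gb_succ_succ n k
  obtain ⟨d, rfl⟩ : ∃ d, n = k + d := ⟨n - k, by omega⟩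
  rw [show k + d - k = d by omega] at *
  linear_combination h3 - h2

lemma gb_symm_add (k d : ℕ) : gb (k + d) k = gb (k + d) d := by
  induction h : k + d generalizing k d with
  | zero =>
    obtain ⟨rfl, rfl⟩ : k = 0 ∧ d = 0 := by omega
    rfl
  | succ n ih =>
    cases k with
    | zero =>
      obtain rfl : d = n + 1 := by omega
      rw [gb_self, gb_zero_right]
    | succ k =>
      cases d with
      | zero =>
        obtain rfl : k = n := by omega
        rw [gb_self, gb_zero_right]
      | succ d =>
        rw [gb_succ_succ, gb_succ_succ' (by omega), ih k (d + 1) (by omega),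
          ih (k + 1) d (by omega), show n - d = k + 1 by omega]
        ring

/-- Power series with nonnegative coefficients. -/
def NN (f : ℤ⟦X⟧) : Prop := ∀ n, 0 ≤ coeff n f

namespace NN

lemma zero : NN 0 := fun n => by simp

lemma X_pow (k : ℕ) : NN (X ^ k) := fun n => by
  rw [coeff_X_pow]
  split_ifs <;> simp

lemma one : NN 1 := by simpa using X_pow 0

lemma X : NN X := by simpa using X_pow 1

lemma add {f g : ℤ⟦X⟧} (hf : NN f) (hg : NN g) : NN (f + g) := fun n => by
  rw [map_add]
  exact add_nonneg (hf n) (hg n)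

lemma mul {f g : ℤ⟦X⟧} (hf : NN f) (hg : NN g) : NN (f * g) := fun n => by
  rw [coeff_mul]
  exact sum_nonneg fun i _ => mul_nonneg (hf _) (hg _)

lemma sum {ι : Type*} {s : Finset ι} {f : ι → ℤ⟦X⟧} (h : ∀ i ∈ s, NN (f i)) :
    NN (∑ i ∈ s, f i) := fun n => by
  rw [map_sum]
  exact sum_nonneg fun i hi => h i hi n

lemma prod {ι : Type*} {s : Finset ι} {f : ι → ℤ⟦X⟧} (h : ∀ i ∈ s, NN (f i)) :
    NN (∏ i ∈ s, f i) := by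
  classical
  induction s using Finset.induction_on with
  | empty => simpa using one
  | insert a s ha ih =>
    rw [prod_insert ha]
    exact (h a (mem_insert_self a s)).mul (ih fun i hi => h i (mem_insert_of_mem hi))

end NN

lemma NN_gb (n k : ℕ) : NN (gb n k) := by
  induction n generalizing k with
  | zero => cases k with
    | zero => exact NN.one
    | succ k => exact NN.zero
  | succ n ih => cases k with
    | zero => exact NN.one
    | succ k => exact (ih k).add ((NN.X_pow _).mul (ih _))

lemma NN_gb_det_aux (s : ℕ) : ∀ {a b i j e : ℕ}, a + b = s → e + j ≤ i → a + j ≤ b + i →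
    NN (gb a i * gb b (j + 1) - X ^ e * (gb a (i + 1) * gb b j)) := by
  induction s with
  | zero =>
    intro a b i j e hs _ _
    obtain ⟨rfl, rfl⟩ : a = 0 ∧ b = 0 := by omega
    simpa using NN.zero
  | succ s ih =>
    intro a b i j e hs he hab
    by_cases hia : a < i + 1
    · rw [gb_eq_zero hia]
      simpa using (NN_gb a i).mul (NN_gb b (j + 1))
    obtain rfl | hij := (show j ≤ i by omega).eq_or_lt
    · obtain rfl : e = 0 := by omega
      obtain rfl | hlt := (show a ≤ b by omega).eq_or_lt
      · convert NN.zero using 1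
        ring
      obtain ⟨b, rfl⟩ := Nat.exists_eq_succ_of_ne_zero (Nat.ne_zero_of_lt hlt)
      have h1 := ih (a := a) (b := b) (i := j) (j := j) (e := 0) (by omega) (by omega) (by omega)
      cases j with
      | zero =>
        convert h1.add ((NN.X_pow b).mul (NN_gb a 0)) using 1
        rw [Nat.succ_eq_add_one, gb_succ_succ' (Nat.zero_le _)]
        simp only [gb_zero_right, Nat.sub_zero]
        ring
      | succ j =>
        have h2 := ih (a := a) (b := b) (i := j + 1) (j := j) (e := 1) (by omega) (by omega)
          (by omega)
        convert h1.add ((NN.X_pow (b - (j + 1))).mul h2) using 1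
        rw [Nat.succ_eq_add_one, gb_succ_succ' (show j + 1 ≤ b by omega),
          gb_succ_succ' (show j ≤ b by omega), show b - j = b - (j + 1) + 1 by omega]
        ring
    · obtain ⟨i, rfl⟩ := Nat.exists_eq_succ_of_ne_zero (Nat.ne_zero_of_lt hij)
      obtain ⟨a, rfl⟩ := Nat.exists_eq_succ_of_ne_zero (show a ≠ 0 by omega)
      simp only [Nat.succ_eq_add_one] at *
      cases e with
      | zero =>
        have h1 := ih (a := a) (b := b) (i := i) (j := j) (e := 0) (by omega) (by omega) (by omega)
        have h2 := ih (a := a) (b := b) (i := i + 1) (j := j) (e := 1) (by omega) (by omega)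
          (by omega)
        convert h1.add ((NN.X_pow (i + 1)).mul h2) using 1
        rw [gb_succ_succ a i, gb_succ_succ a (i + 1)]
        ring
      | succ e =>
        have h1 := ih (a := a) (b := b) (i := i + 1) (j := j) (e := e + 1) (by omega) (by omega)
          (by omega)
        have h2 := ih (a := a) (b := b) (i := i) (j := j) (e := e) (by omega) (by omega)
          (by omega)
        convert h1.add ((NN.X_pow (a - i)).mul h2) using 1
        rw [gb_succ_succ' (show i ≤ a by omega), gb_succ_succ' (show i + 1 ≤ a by omega),
          show a - i = a - (i + 1) + 1 by omega]
        ring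

/-- A `q`-analogue of the log-concavity of binomial coefficients. -/
lemma NN_gb_det {a b i j e : ℕ} (he : e + j ≤ i) (hab : a + j ≤ b + i) :
    NN (gb a i * gb b (j + 1) - X ^ e * (gb a (i + 1) * gb b j)) :=
  NN_gb_det_aux _ rfl he hab

/-- Gaussian binomial coefficients extended by zero to negative lower index. -/
noncomputable def gz (n : ℕ) (k : ℤ) : ℤ⟦X⟧ := if k < 0 then 0 else gb n k.toNat

@[simp] lemma gz_natCast (n k : ℕ) : gz n k = gb n k := by simp [gz]

lemma gz_neg (n : ℕ) {k : ℤ} (h : k < 0) : gz n k = 0 := if_pos h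

lemma NN_gz (n : ℕ) (k : ℤ) : NN (gz n k) := by
  unfold gz
  split_ifs
  exacts [NN.zero, NN_gb _ _]

lemma gz_eq_zero {n : ℕ} {k : ℤ} (h : (n : ℤ) < k) : gz n k = 0 := by
  unfold gz
  split_ifs
  · rfl
  · exact gb_eq_zero (by omega)

lemma gz_succ (n : ℕ) (k : ℤ) :
    gz (n + 1) k = gz n (k - 1) + X ^ k.toNat * gz n k := by
  rcases lt_trichotomy k 0 with h | rfl | h
  · simp [gz_neg _ h, gz_neg _ (show k - 1 < 0 by omega)]
  · simp [gz]
  · obtain ⟨j, rfl⟩ : ∃ j : ℕ, k = ((j + 1 : ℕ) : ℤ) := ⟨(k - 1).toNat, by omega⟩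
    rw [show ((j + 1 : ℕ) : ℤ) - 1 = (j : ℕ) by omega]
    simp only [gz_natCast, Int.toNat_natCast]
    rfl

lemma gz_succ' (n : ℕ) (k : ℤ) :
    gz (n + 1) k = X ^ (n + 1 - k).toNat * gz n (k - 1) + gz n k := by
  rcases lt_trichotomy k 0 with h | rfl | h
  · simp [gz_neg _ h, gz_neg _ (show k - 1 < 0 by omega)]
  · simp [gz]
  · obtain ⟨j, rfl⟩ : ∃ j : ℕ, k = ((j + 1 : ℕ) : ℤ) := ⟨(k - 1).toNat, by omega⟩
    rw [show ((j + 1 : ℕ) : ℤ) - 1 = (j : ℕ) by omega,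
      show ((n : ℤ) + 1 - (j + 1 : ℕ)).toNat = n - j by omega]
    simp only [gz_natCast]
    by_cases h : j ≤ n
    · exact gb_succ_succ' h
    · rw [gb_eq_zero (by omega), gb_eq_zero (by omega), gb_eq_zero (by omega)]
      simp

/-- The sum `∑ J, q ^ (J (J + e)) [l; J + c] [r; J]` of products of Gaussian binomials. -/
noncomputable def B (e : ℕ) (c : ℤ) (l r : ℕ) : ℤ⟦X⟧ :=
  ∑ J ∈ range (r + 1), X ^ (J * (J + e)) * (gz l (J + c) * gb r J)

lemma NN_B (e : ℕ) (c : ℤ) (l r : ℕ) : NN (B e c l r) :=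
  NN.sum fun _ _ => (NN.X_pow _).mul ((NN_gz _ _).mul (NN_gb _ _))

lemma B_eq_sum {e : ℕ} {c : ℤ} {l r K : ℕ} (h : r < K) :
    B e c l r = ∑ J ∈ range K, X ^ (J * (J + e)) * (gz l (J + c) * gb r J) := by
  refine sum_subset (range_mono h) fun J _ hJ => ?_
  rw [gb_eq_zero (show r < J by simpa [mem_range] using hJ)]
  simp

lemma B_zero_right (e : ℕ) (c : ℤ) (l : ℕ) : B e c l 0 = gz l c := by simp [B]

lemma B_outer_left (e : ℕ) (c : ℤ) (l r d : ℕ) (hd : (d : ℤ) = l + 1 - c) :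
    B (e + 1) c (l + 1) r = B (e + 1) c l r + X ^ d * B e (c - 1) l r := by
  unfold B
  rw [mul_sum, ← sum_add_distrib]
  refine sum_congr rfl fun J _ => ?_
  rw [gz_succ', show (J : ℤ) + c - 1 = J + (c - 1) by ring]
  by_cases hJ : J ≤ d
  · obtain ⟨t, rfl⟩ : ∃ t, d = J + t := ⟨d - J, by omega⟩
    rw [show ((l : ℤ) + 1 - (J + c)).toNat = t by omega]
    ring
  · rw [gz_eq_zero (show (l : ℤ) < J + (c - 1) by omega)]
    ring

lemma B_inner_left (e : ℕ) (c : ℕ) (l r : ℕ) :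
    B e c (l + 1) r = B e (c - 1) l r + X ^ c * B (e + 1) c l r := by
  unfold B
  rw [mul_sum, ← sum_add_distrib]
  refine sum_congr rfl fun J _ => ?_
  rw [gz_succ, show (J : ℤ) + c - 1 = J + (c - 1) by ring,
    show ((J : ℤ) + c).toNat = J + c by omega]
  ring

lemma B_outer_right (e : ℕ) (c : ℤ) (l r : ℕ) :
    B e c l (r + 1) = B e c l r + X ^ (r + 1 + e) * B (e + 1) (c + 1) l r := by
  rw [B_eq_sum (show r < r + 1 + 1 by omega)]
  unfold B
  rw [sum_range_succ', sum_range_succ' _ (r + 1), mul_sum, add_right_comm, ← sum_add_distrib]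
  simp only [gb_zero_right]
  congr 1
  refine sum_congr rfl fun J hJ => ?_
  have hJ' : J ≤ r := by simpa [Nat.lt_succ_iff] using hJ
  rw [gb_succ_succ' hJ', show ((J + 1 : ℕ) : ℤ) + c = J + (c + 1) by push_cast; ring]
  obtain ⟨t, rfl⟩ : ∃ t, r = J + t := ⟨r - J, by omega⟩
  rw [show J + t - J = t by omega]
  ring

lemma B_inner_right (e : ℕ) (c : ℤ) (l r : ℕ) :
    B e c l (r + 1) = B (e + 1) c l r + X ^ (1 + e) * B (e + 2) (c + 1) l r := by
  rw [B_eq_sum (show r < r + 1 + 1 by omega)]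
  unfold B
  rw [sum_range_succ', sum_range_succ' _ (r + 1), mul_sum, add_right_comm, ← sum_add_distrib]
  simp only [gb_zero_right]
  congr 1
  refine sum_congr rfl fun J hJ => ?_
  rw [gb_succ_succ, show ((J + 1 : ℕ) : ℤ) + c = J + (c + 1) by push_cast; ring]
  ring

/-- The `q`-Vandermonde identity. -/
lemma B_vandermonde (c l r : ℕ) : B c c l r = gb (l + r) (r + c) := by
  induction r generalizing c with
  | zero => simp [B_zero_right]
  | succ r ih =>
    rw [B_outer_right, ih]
    have h := ih (c + 1)
    push_cast at h
    rw [h, show l + (r + 1) = l + r + 1 by ring, show r + 1 + c = r + c + 1 by ring, gb_succ_succ]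
    ring_nf

/-- `B e c l (r - 1)`, read as zero for `r = 0`. -/
noncomputable def Bpred (e : ℕ) (c : ℤ) (l : ℕ) : ℕ → ℤ⟦X⟧
  | 0 => 0
  | r + 1 => B e c l r

@[simp] lemma Bpred_zero (e : ℕ) (c : ℤ) (l : ℕ) : Bpred e c l 0 = 0 := rfl

@[simp] lemma Bpred_succ (e : ℕ) (c : ℤ) (l r : ℕ) : Bpred e c l (r + 1) = B e c l r := rfl

/-- The building blocks of the difference of the series counting holes and large ranks. -/
noncomputable def E (m a : ℕ) : ℤ⟦X⟧ :=
  B (m + 1) (m - 1) (a + m) a - X ^ (2 * m + 3) * Bpred (m + 4) (m + 2) (a + m) a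

lemma box_identity (m u : ℕ) :
    X ^ (m + 1) * B (m + 2) (m + 1) (u + 1 + m) u =
      ∑ i ∈ range u, X ^ (i + 2 + m) * gb (2 * i + m + 2) i + X ^ (m + 1) +
        X ^ (2 * m + 3 + u) * Bpred (m + 3) (m + 1) (u + m) u +
        ∑ a ∈ range u, X ^ (2 * a + 3 + m) * E m a := by
  induction u with
  | zero =>
    have h : gz (1 + m) (m + 1) = 1 := by
      rw [show (m : ℤ) + 1 = (m + 1 : ℕ) by push_cast; ring, gz_natCast, add_comm, gb_self]
    simp [Bpred, B_zero_right, h]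
  | succ u ih =>
    have f1 := B_outer_left (m + 1) (m + 1) (u + 1 + m) (u + 1) (u + 1) (by push_cast; ring)
    have f2 := B_outer_right (m + 2) (m + 1) (u + 1 + m) u
    have f3 : gb (2 * u + m + 2) u = B (m + 1) (m + 1) (u + 1 + m) (u + 1) := by
      have h := B_vandermonde (m + 1) (u + 1 + m) (u + 1)
      push_cast at h
      rw [h, show 2 * u + m + 2 = u + (u + m + 2) by ring, gb_symm_add]
      congr 1 <;> ring
    have f4 := B_inner_right (m + 1) (m + 1) (u + 1 + m) u
    have f5 := B_inner_right (m + 1) m (u + 1 + m) u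
    have f6 := B_outer_left (m + 1) m (u + m) u (u + 1) (by push_cast; ring)
    have f7 := B_inner_left (m + 2) (m + 1) (u + m) u
    have f8 : B (m + 3) (m + 1) (u + m) u = Bpred (m + 3) (m + 1) (u + m) u +
        X ^ (u + m + 3) * Bpred (m + 4) (m + 2) (u + m) u := by
      cases u with
      | zero => simp [B_zero_right, Bpred, gz_eq_zero]
      | succ u =>
        rw [B_outer_right]
        simp only [Bpred]
        ring_nf
    push_cast at f7
    rw [sum_range_succ, sum_range_succ, E, Bpred_succ, show u + 1 + 1 + m = u + 1 + m + 1 by ring]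
    simp only [add_sub_cancel_right, add_assoc, Nat.reduceAdd, Int.reduceAdd,
      show 1 + m = m + 1 by ring, show m + (1 + 1) = m + 2 by ring] at *
    linear_combination ih + X ^ (m + 1) * (f1 + f2) +
      X ^ (u + m + 2) * (f5 - f3 - f4 + f6 - f7) - X ^ (u + m + 2) * X ^ (m + 1) * f8

lemma NN_B_sub_B {c e l s : ℕ} (he : e ≤ c + 1) (hl : l ≤ s + c + 1) :
    NN (B (c + 3) c l s - X ^ (c + 4 + e) * B (c + 5) (c + 2) l s) := by
  rw [B_eq_sum (show s < s + 1 + 1 by omega), sum_range_succ', B, add_sub_right_comm, mul_sum,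
    ← sum_sub_distrib]
  refine (NN.sum fun J _ => ?_).add
    ((NN.X_pow _).mul ((NN_gz _ _).mul (NN_gb _ _)))
  convert (NN.X_pow ((J + 1) * (J + 1 + (c + 3)))).mul
    (NN_gb_det (a := l) (b := s) (i := J + 1 + c) (j := J) (e := e) (by omega) (by omega)) using 1
  rw [show ((J + 1 : ℕ) : ℤ) + c = (J + 1 + c : ℕ) by push_cast; ring,
    show (J : ℤ) + (c + 2) = (J + 1 + c + 1 : ℕ) by push_cast; ring, gz_natCast, gz_natCast]
  ring

lemma NN_E_succ (m a : ℕ) : NN (E (m + 1) a) := by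
  cases a with
  | zero => simpa [E] using NN_B _ _ _ _
  | succ s =>
    have h1 := B_outer_left (m + 1) m (s + m + 1) (s + 1) (s + 2) (by push_cast; ring)
    have h2 := B_inner_right (m + 2) m (s + m + 1) s
    have h3 := B_inner_left (m + 5) (m + 3) (s + m + 1) s
    have k1 := NN_B_sub_B (c := m) (e := m + 1) (l := s + m + 1) (s := s) le_rfl le_rfl
    have k2 := NN_B_sub_B (c := m + 1) (e := m) (l := s + m + 1) (s := s) (by omega) (by omega)
    convert (k1.add ((NN.X_pow (m + 3)).mul k2)).add
      ((NN.X_pow (s + 2)).mul (NN_B (m + 1) (m - 1) (s + m + 1) (s + 1))) using 1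
    rw [E, Bpred_succ, show s + 1 + (m + 1) = s + m + 1 + 1 by ring]
    push_cast at h3 ⊢
    simp only [add_sub_cancel_right, add_assoc, Nat.reduceAdd, Int.reduceAdd,
      show 1 + (m + 2) = m + 3 by ring, show (m : ℤ) + 3 - 1 = m + 2 by ring] at *
    linear_combination h1 + h2 - X ^ (2 * m + 5) * h3

/-- The geometric series `1 / (1 - q ^ k)`. -/
noncomputable def geom (k : ℕ) : ℤ⟦X⟧ := mk fun n => if k ∣ n then 1 else 0

lemma NN_geom (k : ℕ) : NN (geom k) := fun n => by
  rw [geom, coeff_mk]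
  split_ifs <;> simp

lemma one_sub_mul_geom {k : ℕ} (hk : k ≠ 0) : (1 - X ^ k) * geom k = 1 := by
  ext n
  rw [sub_mul, one_mul, map_sub, coeff_X_pow_mul', geom, coeff_mk, coeff_one]
  rcases Nat.eq_zero_or_pos n with rfl | hn
  · simp [hk]
  · by_cases h : k ≤ n
    · rw [coeff_mk, if_pos h, if_neg hn.ne']
      simp only [Nat.dvd_sub_self_right]
      obtain rfl | hlt := h.eq_or_lt
      · simp
      · simp [Nat.not_le.2 hlt]
    · have : ¬ k ∣ n := fun h' => h (Nat.le_of_dvd hn h')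
      simp [h, this, hn.ne']

lemma one_sub_mul_prod_geom {s : Finset ℕ} {a : ℕ} (ha : a ∈ s) (h0 : a ≠ 0) :
    (1 - X ^ a) * ∏ k ∈ s, geom k = ∏ k ∈ s.erase a, geom k := by
  rw [← mul_prod_erase s geom ha, ← mul_assoc, one_sub_mul_geom h0, one_mul]

lemma NN_prod_geom (s : Finset ℕ) : NN (∏ k ∈ s, geom k) := NN.prod fun k _ => NN_geom k

/-- The product of `1 / (1 - q ^ k)` over `2 ≤ k ≤ s + 2`. -/
noncomputable def geomProd (s : ℕ) : ℤ⟦X⟧ := ∏ k ∈ Icc 2 (s + 2), geom k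

lemma geomProd_succ (s : ℕ) : geomProd (s + 1) = geomProd s * geom (s + 3) := by
  rw [geomProd, geomProd, ← prod_Icc_succ_top (by omega)]

lemma one_sub_mul_geomProd_succ (s : ℕ) : (1 - X ^ (s + 3)) * geomProd (s + 1) = geomProd s := by
  rw [geomProd_succ, mul_left_comm, one_sub_mul_geom (by omega), mul_one]

lemma NN_one_sub_mul_geomProd {s a : ℕ} (ha : 2 ≤ a) (has : a ≤ s + 2) :
    NN ((1 - X ^ a) * geomProd s) := by
  rw [geomProd, one_sub_mul_prod_geom (by simp; omega) (by omega)]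
  exact NN_prod_geom _

lemma NN_one_sub_mul_one_sub_mul_geomProd {s a b : ℕ} (ha : 2 ≤ a) (has : a ≤ s + 2)
    (hb : 2 ≤ b) (hbs : b ≤ s + 2) (hab : a ≠ b) :
    NN ((1 - X ^ a) * ((1 - X ^ b) * geomProd s)) := by
  rw [geomProd, one_sub_mul_prod_geom (by simp; omega) (by omega),
    one_sub_mul_prod_geom (by simp; omega) (by omega)]
  exact NN_prod_geom _

/-- The numerator of the series `∑ a, q ^ (2 a) [a; x] [a; y]`. -/
noncomputable def num (x y : ℕ) : ℤ⟦X⟧ :=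
  ∑ i ∈ range (x + 1), X ^ (2 * (x + y - i) + (x - i) * (y - i)) * (gb x i * gb y i)

lemma num_eq_sum {x y K : ℕ} (h : x < K) :
    num x y = ∑ i ∈ range K, X ^ (2 * (x + y - i) + (x - i) * (y - i)) * (gb x i * gb y i) := by
  refine sum_subset (range_mono h) fun J _ hJ => ?_
  rw [gb_eq_zero (show x < J by simpa [mem_range] using hJ)]
  simp

lemma num_zero_right (x : ℕ) : num x 0 = X ^ (2 * x) := by
  rw [num, sum_range_succ', sum_eq_zero]
  · simp
  · intro i _
    simp

lemma num_zero_left (y : ℕ) : num 0 y = X ^ (2 * y) := by simp [num]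

lemma num_succ_succ (x y : ℕ) :
    num (x + 1) (y + 1) = X ^ 2 * ((1 - X ^ (x + y + 3)) * num x y +
      X ^ (y + 1) * num x (y + 1) + X ^ (x + 1) * num (x + 1) y) := by
  set F : ℕ → ℕ := fun i => 2 * (x + 1 + (y + 1) - i) + (x + 1 - i) * (y + 1 - i) with hF
  have h0 : num (x + 1) (y + 1) =
      ∑ i ∈ range (x + 1 + 1), X ^ F i * (gb (x + 1) i * gb (y + 1) i) := rfl
  have h1 : X ^ (y + 3) * num x (y + 1) =
      ∑ i ∈ range (x + 1 + 1), X ^ (F i + i) * (gb x i * gb (y + 1) i) := by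
    rw [num_eq_sum (show x < x + 1 + 1 by omega), mul_sum]
    refine sum_congr rfl fun i _ => ?_
    by_cases hx : x < i
    · simp [gb_eq_zero hx]
    by_cases hy : y + 1 < i
    · simp [gb_eq_zero hy]
    obtain ⟨s, rfl⟩ : ∃ s, x = i + s := ⟨x - i, by omega⟩
    obtain ⟨t, ht⟩ : ∃ t, y + 1 = i + t := ⟨y + 1 - i, by omega⟩
    simp only [hF]
    rw [← mul_assoc, ← pow_add, show y + 3 = i + t + 2 by omega, ht]
    congr 2
    rw [show i + s + (i + t) - i = i + s + t by omega, show i + s - i = s by omega,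
      show i + t - i = t by omega, show i + s + 1 + (i + t) - i = i + s + 1 + t by omega,
      show i + s + 1 - i = s + 1 by omega]
    ring
  have h2 : X ^ (x + 3) * num (x + 1) y =
      ∑ i ∈ range (x + 1 + 1), X ^ (F i + i) * (gb (x + 1) i * gb y i) := by
    rw [num, mul_sum]
    refine sum_congr rfl fun i _ => ?_
    by_cases hx : x + 1 < i
    · simp [gb_eq_zero hx]
    by_cases hy : y < i
    · simp [gb_eq_zero hy]
    obtain ⟨s, rfl⟩ : ∃ s, y = i + s := ⟨y - i, by omega⟩
    obtain ⟨t, ht⟩ : ∃ t, x + 1 = i + t := ⟨x + 1 - i, by omega⟩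
    simp only [hF]
    rw [← mul_assoc, ← pow_add, show x + 3 = i + t + 2 by omega, ht]
    congr 2
    rw [show i + t + (i + s) - i = i + s + t by omega, show i + s - i = s by omega,
      show i + t - i = t by omega, show i + t + (i + s + 1) - i = i + s + 1 + t by omega,
      show i + s + 1 - i = s + 1 by omega]
    ring
  have h3 : X ^ (x + y + 5) * num x y =
      ∑ i ∈ range (x + 1 + 1), X ^ (F i + 2 * i) * (gb x i * gb y i) := by
    rw [num_eq_sum (show x < x + 1 + 1 by omega), mul_sum]
    refine sum_congr rfl fun i _ => ?_
    by_cases hx : x < i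
    · simp [gb_eq_zero hx]
    by_cases hy : y < i
    · simp [gb_eq_zero hy]
    obtain ⟨s, rfl⟩ : ∃ s, y = i + s := ⟨y - i, by omega⟩
    obtain ⟨t, rfl⟩ : ∃ t, x = i + t := ⟨x - i, by omega⟩
    simp only [hF]
    rw [← mul_assoc, ← pow_add]
    congr 2
    rw [show i + t + (i + s) - i = i + s + t by omega, show i + s - i = s by omega,
      show i + t - i = t by omega, show i + t + 1 + (i + s + 1) - i = i + s + 2 + t by omega,
      show i + s + 1 - i = s + 1 by omega, show i + t + 1 - i = t + 1 by omega]
    ring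
  have h4 : X ^ 2 * num x y =
      ∑ i ∈ range (x + 1), X ^ F (i + 1) * (gb x i * gb y i) := by
    rw [num, mul_sum]
    refine sum_congr rfl fun i hi => ?_
    rw [mem_range] at hi
    simp only [hF]
    rw [← mul_assoc, ← pow_add, Nat.add_sub_add_right, Nat.add_sub_add_right,
      show x + 1 + (y + 1) - (i + 1) = x + y - i + 1 by omega]
    congr 2
    ring
  have key : ∑ i ∈ range (x + 1 + 1), X ^ F i * (gb (x + 1) i * gb (y + 1) i) -
      ∑ i ∈ range (x + 1 + 1), X ^ (F i + i) * (gb x i * gb (y + 1) i) -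
      ∑ i ∈ range (x + 1 + 1), X ^ (F i + i) * (gb (x + 1) i * gb y i) +
      ∑ i ∈ range (x + 1 + 1), X ^ (F i + 2 * i) * (gb x i * gb y i) =
      ∑ i ∈ range (x + 1), X ^ F (i + 1) * (gb x i * gb y i) := by
    rw [← sum_sub_distrib, ← sum_sub_distrib, ← sum_add_distrib, sum_range_succ']
    simp only [gb_zero_right, add_zero, mul_zero, mul_one, sub_self, zero_sub, neg_add_cancel]
    refine sum_congr rfl fun i _ => ?_
    rw [gb_succ_succ, gb_succ_succ]
    ring
  linear_combination key + h0 - h1 - h2 + h3 - h4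

/-- The closed form of the series `∑ a, q ^ (2 a) [a; x] [a; y]`. -/
noncomputable def closed (x y : ℕ) : ℤ⟦X⟧ := num x y * geomProd (x + y)

lemma closed_zero_zero : closed 0 0 = 1 + X ^ 2 * closed 0 0 := by
  have h := one_sub_mul_geom (k := 2) (by omega)
  simp only [closed, num_zero_right, geomProd, mul_zero, pow_zero, one_mul, add_zero, zero_add,
    Icc_self, prod_singleton]
  linear_combination h

lemma closed_succ_zero (x : ℕ) :
    closed (x + 1) 0 = X ^ 2 * (closed x 0 + X ^ (x + 1) * closed (x + 1) 0) := by
  have h := one_sub_mul_geomProd_succ x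
  simp only [closed, num_zero_right, add_zero]
  linear_combination X ^ (2 * x + 2) * h

lemma closed_zero_succ (y : ℕ) :
    closed 0 (y + 1) = X ^ 2 * (closed 0 y + X ^ (y + 1) * closed 0 (y + 1)) := by
  have h := one_sub_mul_geomProd_succ y
  simp only [closed, num_zero_left, zero_add]
  linear_combination X ^ (2 * y + 2) * h

lemma closed_succ_succ (x y : ℕ) :
    closed (x + 1) (y + 1) = X ^ 2 * (closed x y + X ^ (y + 1) * closed x (y + 1) +
      X ^ (x + 1) * closed (x + 1) y + X ^ (x + y + 2) * closed (x + 1) (y + 1)) := by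
  have h1 := one_sub_mul_geomProd_succ (x + y)
  have h2 := one_sub_mul_geomProd_succ (x + y + 1)
  simp only [closed]
  rw [show x + 1 + (y + 1) = x + y + 1 + 1 by ring, show x + (y + 1) = x + y + 1 by ring,
    show x + 1 + y = x + y + 1 by ring]
  linear_combination num (x + 1) (y + 1) * h2 + geomProd (x + y + 1) * num_succ_succ x y +
    X ^ 2 * num x y * h1

/-- The partial sums of the series `∑ a, q ^ (2 a) [a; x] [a; y]`. -/
noncomputable def partialSum (u x y : ℕ) : ℤ⟦X⟧ :=
  ∑ a ∈ range u, X ^ (2 * a) * (gb a x * gb a y)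

lemma dvd_partialSum_sub_closed (u x y : ℕ) :
    X ^ (2 * u) ∣ partialSum u x y - closed x y := by
  induction u generalizing x y with
  | zero => simp
  | succ u ih =>
    rw [partialSum, sum_range_succ', mul_add, pow_add, mul_comm (X ^ (2 * u))]
    have step : ∀ f g : ℤ⟦X⟧, X ^ (2 * u) ∣ g → f = X ^ 2 * g → X ^ (2 * 1) * X ^ (2 * u) ∣ f := by
      rintro f g hg rfl
      exact mul_dvd_mul_left _ hg
    have shift : ∀ f : ℕ → ℤ⟦X⟧, ∑ a ∈ range u, X ^ (2 * (a + 1)) * f a =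
        X ^ 2 * ∑ a ∈ range u, X ^ (2 * a) * f a := fun f => by
      rw [mul_sum]
      exact sum_congr rfl fun i _ => by ring
    cases x with
    | zero =>
      cases y with
      | zero =>
        refine step _ _ (ih 0 0) ?_
        rw [shift]
        simp only [partialSum, gb_zero_right, mul_zero, pow_zero]
        linear_combination - closed_zero_zero
      | succ y =>
        refine step _ _ (dvd_add (ih 0 y) ((ih 0 (y + 1)).mul_left (X ^ (y + 1)))) ?_
        rw [shift]
        simp only [partialSum, gb_zero_right, gb_succ_succ, mul_add, sum_add_distrib, one_mul,
          gb_zero_succ, mul_zero, add_zero, mul_left_comm _ (X ^ (y + 1)), ← mul_sum]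
        linear_combination - closed_zero_succ y
    | succ x =>
      cases y with
      | zero =>
        refine step _ _ (dvd_add (ih x 0) ((ih (x + 1) 0).mul_left (X ^ (x + 1)))) ?_
        rw [shift]
        simp only [partialSum, gb_zero_right, gb_succ_succ, mul_add, sum_add_distrib, mul_one,
          gb_zero_succ, mul_zero, add_zero, mul_left_comm _ (X ^ (x + 1)), ← mul_sum]
        linear_combination - closed_succ_zero x
      | succ y =>
        refine step _ _ (dvd_add (dvd_add (dvd_add (ih x y)
          ((ih x (y + 1)).mul_left (X ^ (y + 1)))) ((ih (x + 1) y).mul_left (X ^ (x + 1))))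
          ((ih (x + 1) (y + 1)).mul_left (X ^ (x + y + 2)))) ?_
        have h : ∑ a ∈ range u, X ^ (2 * a) * (gb (a + 1) (x + 1) * gb (a + 1) (y + 1)) =
            partialSum u x y + X ^ (y + 1) * partialSum u x (y + 1) +
            X ^ (x + 1) * partialSum u (x + 1) y +
            X ^ (x + y + 2) * partialSum u (x + 1) (y + 1) := by
          simp only [partialSum, mul_sum, ← sum_add_distrib]
          refine sum_congr rfl fun a _ => ?_
          rw [gb_succ_succ, gb_succ_succ]
          ring
        rw [shift, h]
        simp only [gb_zero_succ, mul_zero, add_zero]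
        linear_combination - closed_succ_succ x y

lemma sum_E_zero {v K : ℕ} (hK : v < K) :
    ∑ a ∈ range (v + 1), X ^ (2 * a + 3) * E 0 a =
      X ^ 3 * (∑ k ∈ range K, X ^ ((k + 1) * (k + 2)) * partialSum (v + 1) k (k + 1) -
        ∑ k ∈ range K, X ^ (k ^ 2 + 4 * k + 5) *
          (partialSum v k (k + 1) + X ^ (k + 2) * partialSum v k (k + 2))) := by
  have h1 : ∀ a ∈ range (v + 1), B 1 (-1) a a =
      ∑ k ∈ range K, X ^ ((k + 1) * (k + 2)) * (gb a k * gb a (k + 1)) := by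
    intro a ha
    rw [mem_range] at ha
    rw [B_eq_sum (show a < K + 1 by omega), sum_range_succ', gz_neg _ (by simp)]
    simp
  have h2 : ∀ s ∈ range v, B 4 2 (s + 1) s = ∑ k ∈ range K,
      X ^ (k * (k + 4)) * (gb s k * gb s (k + 1) + X ^ (k + 2) * (gb s k * gb s (k + 2))) := by
    intro s hs
    rw [mem_range] at hs
    rw [B_eq_sum (show s < K by omega)]
    refine sum_congr rfl fun k _ => ?_
    rw [show (k : ℤ) + 2 = (k + 1 + 1 : ℕ) by push_cast; ring, gz_natCast, gb_succ_succ]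
    ring
  simp only [E, mul_sub, sum_sub_distrib]
  congr 1
  · simp only [partialSum, mul_sum]
    rw [sum_comm]
    refine sum_congr rfl fun a ha => ?_
    have := h1 a ha
    simp only [zero_add, Nat.cast_zero, zero_sub, add_zero]
    rw [this, mul_sum]
    exact sum_congr rfl fun i _ => by ring
  · rw [sum_range_succ']
    simp only [partialSum, mul_sum, ← sum_add_distrib]
    rw [sum_comm]
    simp only [Bpred_zero, mul_zero, add_zero]
    refine sum_congr rfl fun a ha => ?_
    have := h2 a ha
    simp only [zero_add, Nat.cast_zero, Bpred_succ]
    rw [this, mul_sum, mul_sum]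
    exact sum_congr rfl fun i _ => by ring

/-- The limit of the series `∑ a, q ^ (2 a) E 0 a`. -/
noncomputable def limitE (K : ℕ) : ℤ⟦X⟧ :=
  X ^ 2 * (1 - X ^ 3) * closed 0 1 + ∑ k ∈ range K, X ^ (k ^ 2 + 5 * k + 6) *
    ((1 - X ^ (k + 4)) * closed (k + 1) (k + 2) - X * closed k (k + 2))

lemma limitE_eq (K : ℕ) :
    limitE K = ∑ k ∈ range (K + 1), X ^ ((k + 1) * (k + 2)) * closed k (k + 1) -
        ∑ k ∈ range (K + 1), X ^ (k ^ 2 + 4 * k + 5) *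
          (closed k (k + 1) + X ^ (k + 2) * closed k (k + 2)) + X ^ (K ^ 2 + 5 * K + 7) *
          closed K (K + 2) := by
  induction K with
  | zero => simp [limitE]; ring
  | succ K ih =>
    rw [sum_range_succ, sum_range_succ _ (K + 1)]
    have h : limitE (K + 1) = limitE K + X ^ (K ^ 2 + 5 * K + 6) *
        ((1 - X ^ (K + 4)) * closed (K + 1) (K + 2) - X * closed K (K + 2)) := by
      rw [limitE, sum_range_succ, ← add_assoc, ← limitE]
    rw [h, ih]
    ring_nf

lemma dvd_sum_E_zero_sub_limitE (v : ℕ) :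
    X ^ v ∣ ∑ a ∈ range (v + 1), X ^ (2 * a + 3) * E 0 a - X ^ 3 * limitE v := by
  have hle : ∀ {w : ℕ}, v ≤ w → (X ^ v : ℤ⟦X⟧) ∣ X ^ w := fun h => pow_dvd_pow _ h
  rw [sum_E_zero (Nat.lt_succ_self v), limitE_eq]
  have e : ∀ a b c d r : ℤ⟦X⟧, X ^ 3 * (a - b) - X ^ 3 * (c - d + r) =
      X ^ 3 * ((a - c) - (b - d)) - X ^ 3 * r := fun a b c d r => by ring
  rw [e, ← sum_sub_distrib, ← sum_sub_distrib]
  refine dvd_sub (Dvd.dvd.mul_left (dvd_sub (dvd_sum fun k _ => ?_) (dvd_sum fun k _ => ?_)) _)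
    (Dvd.dvd.mul_left ((hle (by nlinarith)).mul_right _) _)
  · rw [← mul_sub]
    exact ((hle (by omega)).trans (dvd_partialSum_sub_closed (v + 1) k (k + 1))).mul_left _
  · rw [← mul_sub, add_sub_add_comm, ← mul_sub]
    exact (dvd_add ((hle (by omega)).trans (dvd_partialSum_sub_closed v k (k + 1)))
      (((hle (by omega)).trans (dvd_partialSum_sub_closed v k (k + 2))).mul_left _)).mul_left _

lemma num_add (x d : ℕ) : num x (x + d) = X ^ (2 * (x + d)) * B (d + 2) d (x + d) x := by
  rw [num, B, mul_sum, ← sum_range_reflect]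
  refine sum_congr rfl fun J hJ => ?_
  obtain ⟨t, rfl⟩ : ∃ t, x = J + t := ⟨x - J, by rw [mem_range] at hJ; omega⟩
  rw [show J + t + 1 - 1 - J = t by omega, show J + t + (J + t + d) - t = J + t + d + J by omega,
    show J + t - t = J by omega, show J + t + d - t = J + d by omega, ← Nat.cast_add, gz_natCast,
    gb_symm_add J t, show J + t + d = t + (J + d) by ring, gb_symm_add t]
  ring

lemma one_sub_X_pow_ne_zero {k : ℕ} (hk : k ≠ 0) : (1 - X ^ k : ℤ⟦X⟧) ≠ 0 := fun h => by
  have := one_sub_mul_geom hk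
  rw [h, zero_mul] at this
  exact zero_ne_one this

/-- The `q`-Narayana numbers. -/
noncomputable def nar (k i : ℕ) : ℤ⟦X⟧ :=
  gb (k + 1) i * gb k i - X * (gb (k + 1) (i + 1) * if i = 0 then 0 else gb k (i - 1))

lemma NN_nar (k i : ℕ) : NN (nar k i) := by
  cases i with
  | zero => simpa [nar] using NN.one
  | succ i =>
    simpa [nar] using NN_gb_det (a := k + 1) (b := k) (i := i + 1) (j := i) (e := 1)
      (by omega) (by omega)

lemma one_sub_mul_nar {k i : ℕ} (h : i ≤ k + 1) :
    (1 - X ^ (i + 1)) * nar k i = (1 - X) * (gb (k + 1) i * gb k i) := by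
  cases i with
  | zero => simp [nar]
  | succ i =>
    have h1 := gb_mul_succ h
    have h2 := gb_mul_succ (show i ≤ k by omega)
    rw [show k + 1 - (i + 1) = k - i by omega] at h1
    simp only [nar, Nat.succ_ne_zero, if_false, Nat.add_sub_cancel]
    linear_combination - X * gb k i * h1 + X * gb (k + 1) (i + 1) * h2

lemma one_sub_mul_nar_succ {k i : ℕ} (h : i ≤ k) :
    (1 - X ^ (i + 1)) * nar k (i + 1) = (1 - X) * (gb (k + 1) (i + 2) * gb k i) := by
  have h1 := gb_mul_succ (show i + 1 ≤ k + 1 by omega)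
  have h2 := gb_mul_succ h
  rw [show k + 1 - (i + 1) = k - i by omega] at h1
  simp only [nar, Nat.succ_ne_zero, if_false, Nat.add_sub_cancel]
  linear_combination gb (k + 1) (i + 1) * h2 - gb k i * h1

lemma nar_succ {k i : ℕ} (h : i ≤ k) :
    (1 - X ^ (i + 1)) * ((1 - X ^ (i + 2)) * nar k (i + 1)) =
      (1 - X ^ (k + 1 - i)) * ((1 - X ^ (k - i)) * nar k i) := by
  have h1 := gb_mul_succ (show i + 1 ≤ k + 1 by omega)
  have h2 := gb_mul_succ (show i ≤ k + 1 by omega)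
  rw [show k + 1 - (i + 1) = k - i by omega] at h1
  apply mul_left_cancel₀ (one_sub_X_pow_ne_zero (show i + 1 ≠ 0 by omega))
  linear_combination (1 - X ^ (i + 1)) * (1 - X ^ (i + 2)) * one_sub_mul_nar_succ h +
    (1 - X) * gb k i * ((1 - X ^ (i + 1)) * h1 + (1 - X ^ (k - i)) * h2) -
    (1 - X ^ (k + 1 - i)) * (1 - X ^ (k - i)) * one_sub_mul_nar (show i ≤ k + 1 by omega)

/-- The `q`-Narayana polynomials. -/
noncomputable def narSum (a k : ℕ) : ℤ⟦X⟧ := ∑ i ∈ range (k + 1), X ^ (i ^ 2 + a * i) * nar k i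

lemma NN_narSum (a k : ℕ) : NN (narSum a k) := NN.sum fun _ _ => (NN.X_pow _).mul (NN_nar _ _)

lemma one_sub_mul_B_three (k : ℕ) :
    (1 - X) * B 3 1 (k + 2) k = (1 - X ^ (k + 2)) * narSum 3 k := by
  rw [B, narSum, mul_sum, mul_sum]
  refine sum_congr rfl fun i hi => ?_
  rw [mem_range] at hi
  have h1 := gb_succ_mul (k + 1) i
  have h2 := one_sub_mul_nar (k := k) (i := i) (by omega)
  rw [show (i : ℤ) + 1 = (i + 1 : ℕ) by push_cast; ring, gz_natCast]
  apply mul_left_cancel₀ (one_sub_X_pow_ne_zero (show i + 1 ≠ 0 by omega))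
  linear_combination (1 - X) * X ^ (i * (i + 3)) * gb k i * h1 -
    (1 - X ^ (k + 2)) * X ^ (i * (i + 3)) * h2

lemma X_mul_B_sub (k : ℕ) :
    X * (B 3 1 (k + 2) k - X * B 4 2 (k + 2) k) = (1 + X) * narSum 4 k - narSum 3 k := by
  have h1 := B_inner_left 3 1 (k + 1) k
  have h2 := B_inner_left 4 2 (k + 1) k
  push_cast at h1 h2
  norm_num at h1 h2
  have h3 : X * (B 3 1 (k + 2) k - X * B 4 2 (k + 2) k) =
      X * B 3 0 (k + 1) k - X ^ 4 * B 5 2 (k + 1) k := by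
    linear_combination X * h1 - X ^ 2 * h2
  have h4 : X ^ 4 * B 5 2 (k + 1) k = ∑ i ∈ range (k + 1), X ^ (i ^ 2 + 3 * i) *
      (gb (k + 1) (i + 1) * if i = 0 then 0 else gb k (i - 1)) := by
    rw [B, sum_range_succ, gz_eq_zero (by push_cast; omega), sum_range_succ']
    simp only [zero_mul, mul_zero, add_zero, mul_sum, if_true, Nat.succ_ne_zero, if_false,
      Nat.add_sub_cancel]
    refine sum_congr rfl fun i _ => ?_
    rw [show (i : ℤ) + 2 = (i + 2 : ℕ) by push_cast; ring, gz_natCast]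
    ring
  rw [h3, h4, B, narSum, narSum, mul_sum, mul_sum, ← sum_sub_distrib, ← sum_sub_distrib]
  refine sum_congr rfl fun i hi => ?_
  rw [mem_range] at hi
  have h5 := one_sub_mul_nar (k := k) (i := i) (by omega)
  have h6 : (1 - X ^ i) * nar k i =
      (1 - X) * (gb (k + 1) (i + 1) * if i = 0 then 0 else gb k (i - 1)) := by
    cases i with
    | zero => simp
    | succ i => simpa using one_sub_mul_nar_succ (k := k) (i := i) (by omega)
  apply mul_left_cancel₀ (one_sub_X_pow_ne_zero one_ne_zero)
  simp only [add_zero, gz_natCast]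
  linear_combination X ^ (i ^ 2 + 3 * i) * (h6 - X * h5)

lemma narSum_three_term (k : ℕ) :
    narSum 3 k - (1 + X) * narSum 4 k + X * narSum 5 k =
      X ^ 4 * (narSum 5 k - (X ^ (k + 1) + X ^ k) * narSum 4 k +
        X ^ (2 * k + 1) * narSum 3 k) := by
  have h1 : narSum 3 k - (1 + X) * narSum 4 k + X * narSum 5 k = ∑ i ∈ range (k + 1),
      X ^ (i ^ 2 + 3 * i) * ((1 - X ^ i) * ((1 - X ^ (i + 1)) * nar k i)) := by
    simp only [narSum, mul_sum, ← sum_sub_distrib, ← sum_add_distrib]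
    exact sum_congr rfl fun i _ => by ring
  have h2 : X ^ 4 * (narSum 5 k - (X ^ (k + 1) + X ^ k) * narSum 4 k +
      X ^ (2 * k + 1) * narSum 3 k) = ∑ i ∈ range (k + 1), X ^ (i ^ 2 + 5 * i + 4) *
        ((1 - X ^ (k + 1 - i)) * ((1 - X ^ (k - i)) * nar k i)) := by
    simp only [narSum, mul_sum, ← sum_sub_distrib, ← sum_add_distrib]
    refine sum_congr rfl fun i hi => ?_
    obtain ⟨t, rfl⟩ : ∃ t, k = i + t := ⟨k - i, by rw [mem_range] at hi; omega⟩
    rw [show i + t + 1 - i = t + 1 by omega, show i + t - i = t by omega]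
    ring
  rw [h1, h2, sum_range_succ', sum_range_succ]
  simp only [pow_zero, tsub_self, pow_zero, sub_self, zero_mul, mul_zero, add_zero]
  refine sum_congr rfl fun i hi => ?_
  rw [mem_range] at hi
  linear_combination X ^ (i ^ 2 + 5 * i + 4) * nar_succ (show i ≤ k by omega)

lemma one_sub_mul_B_sub (k : ℕ) :
    (1 - X ^ (2 * k + 5)) * (B 3 1 (k + 2) k - X * B 4 2 (k + 2) k) =
      (1 - X ^ 3) * narSum 5 k + X ^ (k + 3) * (1 + X) * ((1 - X ^ (k + 1)) * narSum 4 k) := by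
  have h1 := X_mul_B_sub k
  have h2 := narSum_three_term k
  apply mul_left_cancel₀ (X_ne_zero : (X : ℤ⟦X⟧) ≠ 0)
  linear_combination (1 - X ^ (2 * k + 5)) * h1 - h2

lemma bracket_eq (k : ℕ) :
    (1 - X ^ (k + 4)) * closed (k + 1) (k + 2) - X * closed k (k + 2) =
      X ^ (2 * (k + 2)) * (geomProd (2 * k + 3) *
        ((1 - X ^ (k + 3)) * (B 3 1 (k + 2) k - X * B 4 2 (k + 2) k) +
          X ^ (k + 3) * ((1 - X) * B 3 1 (k + 2) k) +
          X ^ (2 * k + 6) * ((1 - X ^ 2) * B 4 2 (k + 2) k))) := by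
  have h1 := num_add (k + 1) 1
  have h2 := num_add k 2
  have h3 := B_outer_right 3 1 (k + 2) k
  have h4 := one_sub_mul_geomProd_succ (2 * k + 2)
  norm_num at h1 h2 h3
  rw [closed, closed, show k + 1 + (k + 2) = 2 * k + 3 by ring,
    show k + (k + 2) = 2 * k + 2 by ring,
    ← h4, h1, h2, h3]
  ring

lemma NN_bracket (k : ℕ) :
    NN ((1 - X ^ (k + 4)) * closed (k + 1) (k + 2) - X * closed k (k + 2)) := by
  rw [bracket_eq]
  refine (NN.X_pow _).mul ?_
  rw [one_sub_mul_B_three, mul_add, mul_add]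
  refine NN.add (NN.add ?_ ?_) ?_
  · cases k with
    | zero =>
      have h : B 3 1 2 0 - X * B 4 2 2 0 = 1 := by
        have h1 := gz_natCast 2 1
        have h2 := gz_natCast 2 2
        norm_num at h1 h2
        rw [B_zero_right, B_zero_right, h1, h2, gb_succ_succ, gb_succ_succ, gb_self 2]
        simp
      simp only [zero_add, h, mul_one]
      rw [mul_comm]
      exact NN_one_sub_mul_geomProd (by omega) (by omega)
    | succ k =>
      have h := one_sub_mul_B_sub (k + 1)
      have h1 := one_sub_mul_geom (k := 2 * k + 7) (by omega)
      have h2 : geomProd (2 * (k + 1) + 3) * ((1 - X ^ (k + 1 + 3)) *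
          (B 3 1 (k + 1 + 2) (k + 1) - X * B 4 2 (k + 1 + 2) (k + 1))) = geom (2 * k + 7) *
          (((1 - X ^ 3) * ((1 - X ^ (k + 4)) * geomProd (2 * k + 5))) * narSum 5 (k + 1) +
            X ^ (k + 4) * (1 + X) * (((1 - X ^ (k + 2)) * ((1 - X ^ (k + 4)) *
              geomProd (2 * k + 5))) * narSum 4 (k + 1))) := by
        rw [show 2 * (k + 1) + 3 = 2 * k + 5 by ring, show 2 * (k + 1) + 5 = 2 * k + 7 by ring] at *
        linear_combination geomProd (2 * k + 5) * (1 - X ^ (k + 1 + 3)) * geom (2 * k + 7) * h -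
          geomProd (2 * k + 5) * ((1 - X ^ (k + 1 + 3)) *
          (B 3 1 (k + 1 + 2) (k + 1) - X * B 4 2 (k + 1 + 2) (k + 1))) * h1
      rw [h2]
      refine (NN_geom _).mul (((NN_one_sub_mul_one_sub_mul_geomProd ?_ ?_ ?_ ?_ ?_).mul
        (NN_narSum _ _)).add (((NN.X_pow _).mul (NN.one.add NN.X)).mul
        ((NN_one_sub_mul_one_sub_mul_geomProd ?_ ?_ ?_ ?_ ?_).mul (NN_narSum _ _)))) <;> omega
  · convert (NN.X_pow (k + 3)).mul ((NN_one_sub_mul_geomProd (s := 2 * k + 3) (a := k + 2)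
      (by omega) (by omega)).mul (NN_narSum 3 k)) using 1
    ring
  · convert (NN.X_pow (2 * k + 6)).mul ((NN_one_sub_mul_geomProd (s := 2 * k + 3) (a := 2)
      (by omega) (by omega)).mul (NN_B 4 2 (k + 2) k)) using 1
    ring

lemma NN_limitE (K : ℕ) : NN (limitE K) := by
  refine NN.add ?_ (NN.sum fun k _ => (NN.X_pow _).mul (NN_bracket k))
  rw [mul_assoc, closed, num_zero_left, mul_left_comm (1 - X ^ 3)]
  exact (NN.X_pow _).mul ((NN.X_pow _).mul (NN_one_sub_mul_geomProd (by omega) (by omega)))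

open Classical in
/-- The generating function of the partitions whose multiset of parts satisfies `Q`. -/
noncomputable def gf (Q : Multiset ℕ → Prop) : ℤ⟦X⟧ :=
  mk fun n => ((univ.filter fun l : n.Partition => Q l.parts).card : ℤ)

lemma coeff_gf (Q : Multiset ℕ → Prop) (n : ℕ) [DecidablePred fun l : n.Partition => Q l.parts] :
    coeff n (gf Q) = ((univ.filter fun l : n.Partition => Q l.parts).card : ℤ) := by
  rw [gf, coeff_mk]
  congr!

lemma coeff_gf_congr {Q R : Multiset ℕ → Prop} {n : ℕ}
    (h : ∀ s : Multiset ℕ, (∀ x ∈ s, 0 < x) → s.sum = n → (Q s ↔ R s)) :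
    coeff n (gf Q) = coeff n (gf R) := by
  classical
  rw [coeff_gf, coeff_gf]
  congr 2
  ext l
  simp [h l.parts (fun x hx => l.parts_pos hx) l.parts_sum]

lemma gf_congr {Q R : Multiset ℕ → Prop} (h : ∀ s : Multiset ℕ, (∀ x ∈ s, 0 < x) → (Q s ↔ R s)) :
    gf Q = gf R := by
  ext n
  exact coeff_gf_congr fun s hs _ => h s hs

lemma X_pow_dvd_gf_sub {Q R : Multiset ℕ → Prop} {u : ℕ}
    (h : ∀ s : Multiset ℕ, (∀ x ∈ s, 0 < x) → s.sum < u → (Q s ↔ R s)) :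
    X ^ u ∣ gf Q - gf R := by
  rw [X_pow_dvd_iff]
  intro n hn
  rw [map_sub, coeff_gf_congr fun s hs hsum => h s hs (hsum ▸ hn), sub_self]

lemma coeff_gf_mono {Q R : Multiset ℕ → Prop} (h : ∀ s, Q s → R s) (n : ℕ) :
    coeff n (gf Q) ≤ coeff n (gf R) := by
  classical
  rw [coeff_gf, coeff_gf]
  exact_mod_cast card_le_card (monotone_filter_right _ fun l _ hl => h _ hl)

lemma gf_split (Q R : Multiset ℕ → Prop) :
    gf Q = gf (fun s => Q s ∧ R s) + gf (fun s => Q s ∧ ¬ R s) := by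
  classical
  ext n
  rw [map_add, coeff_gf, coeff_gf, coeff_gf, ← Nat.cast_add,
    ← card_filter_add_card_filter_not (fun l : n.Partition => R l.parts), filter_filter,
    filter_filter]

lemma gf_sub_of_imp {Q R : Multiset ℕ → Prop} (h : ∀ s, R s → Q s) :
    gf Q - gf R = gf (fun s => Q s ∧ ¬ R s) := by
  rw [gf_split Q R, gf_congr (Q := fun s => Q s ∧ R s) (R := R)
    fun s _ => ⟨fun hs => hs.2, fun hs => ⟨h s hs, hs⟩⟩]
  ring

lemma gf_not (Q : Multiset ℕ → Prop) : gf (fun s => ¬ Q s) = gf (fun _ => True) - gf Q := by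
  rw [gf_sub_of_imp fun _ _ => trivial]
  exact gf_congr fun s _ => by simp

lemma gf_eq_zero {Q : Multiset ℕ → Prop} (h : ∀ s : Multiset ℕ, (∀ x ∈ s, 0 < x) → ¬ Q s) :
    gf Q = 0 := by
  have := gf_sub_of_imp (Q := Q) (R := Q) fun _ h => h
  rw [sub_self] at this
  rw [this]
  exact gf_congr fun s hs => by simp [h s hs]

lemma gf_exists_sum {ι : Type*} (t : Finset ι) (Q : ι → Multiset ℕ → Prop)
    (h : ∀ s i j, Q i s → Q j s → i = j) :
    gf (fun s => ∃ i ∈ t, Q i s) = ∑ i ∈ t, gf (Q i) := by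
  classical
  induction t using Finset.induction_on with
  | empty => simpa using gf_eq_zero (Q := fun _ => False) fun _ _ => id
  | insert a t ha ih =>
    rw [sum_insert ha, ← ih, gf_split _ (Q a)]
    congr 1
    · exact gf_congr fun s _ => ⟨fun hs => hs.2, fun hs => ⟨⟨a, mem_insert_self a t, hs⟩, hs⟩⟩
    · refine gf_congr fun s _ => ⟨?_, ?_⟩
      · rintro ⟨⟨i, hi, hs⟩, hna⟩
        rcases mem_insert.1 hi with rfl | hi
        exacts [absurd hs hna, ⟨i, hi, hs⟩]
      · rintro ⟨i, hi, hs⟩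
        exact ⟨⟨i, mem_insert_of_mem hi, hs⟩, fun hs' => ha (h s i a hs hs' ▸ hi)⟩

lemma gf_mem_and {k : ℕ} (hk : 0 < k) (Q : Multiset ℕ → Prop) :
    gf (fun s => k ∈ s ∧ Q s) = X ^ k * gf (fun s => Q (k ::ₘ s)) := by
  classical
  ext n
  rw [coeff_X_pow_mul', coeff_gf]
  split_ifs with hkn
  · rw [coeff_gf]
    congr 1
    refine card_bij'
      (fun l hl => ⟨l.parts.erase k, fun h => l.parts_pos (Multiset.mem_of_mem_erase h), ?_⟩)
      (fun l _ => ⟨k ::ₘ l.parts, ?_, ?_⟩) ?_ ?_ ?_ ?_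
    · have h := l.parts_sum
      rw [← Multiset.cons_erase (mem_filter.1 hl).2.1, Multiset.sum_cons] at h
      omega
    · intro i hi
      rcases Multiset.mem_cons.1 hi with rfl | hi
      exacts [hk, l.parts_pos hi]
    · rw [Multiset.sum_cons, l.parts_sum]
      omega
    · intro l hl
      have := (mem_filter.1 hl).2
      simpa [Multiset.cons_erase this.1] using this.2
    · intro l hl
      simpa using hl
    · intro l hl
      have := (mem_filter.1 hl).2
      ext1
      exact Multiset.cons_erase this.1
    · intro l hl
      ext1
      simp
  · rw [Nat.cast_eq_zero, card_eq_zero, filter_eq_empty_iff]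
    intro l _ hl
    exact hkn (l.le_of_mem_parts hl.1)

lemma gf_empty : gf (fun s => s = 0) = 1 := by
  classical
  ext n
  rw [coeff_gf, coeff_one]
  split_ifs with h
  · subst h
    rw [Nat.cast_eq_one, card_eq_one]
    exact ⟨default, by ext l; simp [Subsingleton.elim l default]⟩
  · rw [Nat.cast_eq_zero, card_eq_zero, filter_eq_empty_iff]
    intro l _ hl
    have := l.parts_sum
    rw [hl] at this
    exact h this.symm

/-- The partitions with parts at most `M` and at most `K` parts. -/
def Box (M K : ℕ) (s : Multiset ℕ) : Prop := (∀ x ∈ s, x ≤ M) ∧ s.card ≤ K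

lemma gf_Box (M K : ℕ) : gf (Box M K) = gb (M + K) M := by
  induction h : M + K generalizing M K with
  | zero =>
    obtain ⟨rfl, rfl⟩ : M = 0 ∧ K = 0 := by omega
    rw [gb_zero_right, ← gf_empty]
    exact gf_congr fun s _ => ⟨fun hs => by simpa using hs.2, fun hs => by simp [Box, hs]⟩
  | succ n ih =>
    cases M with
    | zero =>
      rw [gb_zero_right, ← gf_empty]
      refine gf_congr fun s hs => ⟨fun h => ?_, fun hs => by simp [Box, hs]⟩
      refine Multiset.eq_zero_of_forall_notMem fun x hx => ?_
      have h1 := hs x hx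
      have h2 := h.1 x hx
      omega
    | succ M =>
      cases K with
      | zero =>
        obtain rfl : M = n := by omega
        rw [gb_self, ← gf_empty]
        exact gf_congr fun s _ => ⟨fun hs => by simpa using hs.2, fun hs => by simp [Box, hs]⟩
      | succ K =>
        rw [gb_succ_succ, ← ih M (K + 1) (by omega), ← ih (M + 1) K (by omega),
          gf_split _ (fun s => M + 1 ∈ s), add_comm]
        congr 1
        · refine gf_congr fun s _ => ⟨fun hs => ⟨fun x hx => ?_, hs.1.2⟩,
            fun hs => ⟨⟨fun x hx => (hs.1 x hx).trans (Nat.le_succ M), hs.2⟩, fun hM => ?_⟩⟩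
          · have h1 := hs.1.1 x hx
            have h2 : x ≠ M + 1 := fun h => hs.2 (h ▸ hx)
            omega
          · have := hs.1 _ hM
            omega
        · rw [gf_congr (R := fun s => M + 1 ∈ s ∧ Box (M + 1) (K + 1) s) fun s _ => and_comm,
            gf_mem_and (Nat.succ_pos M)]
          congr 1
          exact gf_congr fun s _ => by simp [Box]

lemma gf_Box_card {M h : ℕ} : gf (fun s => (∀ x ∈ s, x ≤ M) ∧ s.card = h + 1) =
    X ^ (h + 1) * gb (M + h) (h + 1) := by
  have h1 := gf_sub_of_imp (Q := Box M (h + 1)) (R := Box M h) fun s hs =>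
    ⟨hs.1, hs.2.trans (Nat.le_succ h)⟩
  rw [gf_congr (R := fun s => Box M (h + 1) s ∧ ¬ Box M h s), ← h1, gf_Box, gf_Box, gb_symm_add,
    gb_symm_add, ← add_assoc, gb_succ_succ]
  · ring
  · intro s _
    simp only [Box, not_and, not_le]
    constructor
    · rintro ⟨h1, h2⟩
      exact ⟨⟨h1, h2.le⟩, fun _ => by omega⟩
    · rintro ⟨⟨h1, h2⟩, h3⟩
      have := h3 h1
      exact ⟨h1, by omega⟩

lemma le_sum_of_mem {s : Multiset ℕ} {x : ℕ} (h : x ∈ s) : x ≤ s.sum := Multiset.le_sum_of_mem h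

lemma card_le_sum {s : Multiset ℕ} (hs : ∀ x ∈ s, 0 < x) : s.card ≤ s.sum := by
  simpa using Multiset.card_nsmul_le_sum (s := s) (a := 1) hs

lemma X_pow_dvd_gf_true_sub {u M K : ℕ} (hM : u ≤ M + 1) (hK : u ≤ K + 1) :
    X ^ u ∣ gf (fun _ => True) - gb (M + K) M := by
  rw [← gf_Box]
  refine X_pow_dvd_gf_sub fun s hs hu => ⟨fun _ => ⟨fun x hx => ?_, ?_⟩, fun _ => trivial⟩
  · have := le_sum_of_mem hx
    omega
  · have := card_le_sum hs
    omega

/-- The partitions whose rank is at least `μ`. -/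
def RankGE (μ : ℕ) (s : Multiset ℕ) : Prop := ∃ g ∈ s, (∀ x ∈ s, x ≤ g) ∧ s.card + μ ≤ g

lemma X_pow_dvd_gf_rankGE_sub (μ u : ℕ) :
    X ^ u ∣ gf (RankGE μ) - ∑ i ∈ range u, X ^ (i + μ + 1) * gb (2 * i + μ + 1) i := by
  have h : ∑ i ∈ range u, X ^ (i + μ + 1) * gb (2 * i + μ + 1) i =
      gf (fun s => ∃ i ∈ range u, i + μ + 1 ∈ s ∧ Box (i + μ + 1) (i + 1) s) := by
    rw [gf_exists_sum]
    · refine sum_congr rfl fun i _ => ?_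
      rw [gf_mem_and (show 0 < i + μ + 1 by omega),
        gf_congr (R := Box (i + μ + 1) i) fun s _ => by simp [Box],
        gf_Box, gb_symm_add, show i + μ + 1 + i = 2 * i + μ + 1 by ring]
    · intro s i j hi hj
      have h1 := hi.2.1 _ hj.1
      have h2 := hj.2.1 _ hi.1
      omega
  rw [h]
  refine X_pow_dvd_gf_sub fun s hs hu => ⟨?_, ?_⟩
  · rintro ⟨g, hg, hle, hc⟩
    have h1 := le_sum_of_mem hg
    have h2 : 0 < s.card := Multiset.card_pos_iff_exists_mem.2 ⟨g, hg⟩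
    obtain ⟨i, rfl⟩ : ∃ i, g = i + μ + 1 := ⟨g - μ - 1, by omega⟩
    exact ⟨i, by rw [mem_range]; omega, hg, hle, by omega⟩
  · rintro ⟨i, -, hi, hle, hc⟩
    exact ⟨_, hi, hle, by omega⟩

lemma X_pow_dvd_gf_not_rankGE_sub (m u : ℕ) :
    X ^ u ∣ gf (fun s => ¬ RankGE (m + 3) s) -
      ∑ i ∈ range u, X ^ i * gb (2 * i + m + 1) i := by
  have h : ∑ i ∈ range u, X ^ i * gb (2 * i + m + 1) i =
      gf (fun s => ∃ i ∈ range u, (∀ x ∈ s, x ≤ i + m + 2) ∧ s.card = i) := by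
    rw [gf_exists_sum]
    · refine sum_congr rfl fun i _ => ?_
      cases i with
      | zero =>
        rw [pow_zero, one_mul, gb_zero_right, ← gf_empty]
        exact gf_congr fun s _ => ⟨by rintro rfl; simp, fun h => by simpa using h.2⟩
      | succ i =>
        rw [gf_Box_card]
        congr 2
        omega
    · rintro s i j ⟨-, hi⟩ ⟨-, hj⟩
      exact hi.symm.trans hj
  rw [h]
  refine X_pow_dvd_gf_sub fun s hs hu => ⟨fun hr => ⟨s.card, ?_, fun x hx => ?_, rfl⟩, ?_⟩
  · have := card_le_sum hs
    rw [mem_range]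
    omega
  · by_contra! hlt
    have hne : s.toFinset.Nonempty := ⟨x, by simpa using hx⟩
    obtain ⟨g, hg, hmax⟩ := s.toFinset.exists_max_image id hne
    simp only [Multiset.mem_toFinset, id] at hg hmax
    have := hmax x hx
    exact hr ⟨g, hg, hmax, by omega⟩
  · rintro ⟨i, -, hle, hc⟩ ⟨g, hg, -, hcard⟩
    have := hle g hg
    omega

lemma eq_of_forall_X_pow_dvd_sub {f g : ℤ⟦X⟧} (h : ∀ u, X ^ u ∣ f - g) : f = g := by
  ext n
  have := X_pow_dvd_iff.1 (h (n + 1)) n (Nat.lt_succ_self n)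
  rwa [map_sub, sub_eq_zero] at this

lemma gf_rankGE (m : ℕ) : gf (RankGE m) = X ^ (m + 1) * gf (fun s => ¬ RankGE (m + 3) s) := by
  refine eq_of_forall_X_pow_dvd_sub fun u => ?_
  have h1 := X_pow_dvd_gf_rankGE_sub m u
  have h2 := (X_pow_dvd_gf_not_rankGE_sub m u).mul_left (X ^ (m + 1))
  have h3 : X ^ (m + 1) * ∑ i ∈ range u, X ^ i * gb (2 * i + m + 1) i =
      ∑ i ∈ range u, X ^ (i + m + 1) * gb (2 * i + m + 1) i := by
    rw [mul_sum]
    exact sum_congr rfl fun i _ => by ring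
  convert dvd_sub h1 h2 using 1
  rw [mul_sub, h3]
  ring

/-- The number of elements that are at least `j`. -/
def countGE (j : ℕ) (s : Multiset ℕ) : ℕ := (s.filter (j ≤ ·)).card

lemma countGE_cons_of_le {j k : ℕ} (h : j ≤ k) (s : Multiset ℕ) :
    countGE j (k ::ₘ s) = countGE j s + 1 := by
  simp [countGE, Multiset.filter_cons_of_pos s h]

lemma countGE_cons_of_lt {j k : ℕ} (h : k < j) (s : Multiset ℕ) :
    countGE j (k ::ₘ s) = countGE j s := by
  simp [countGE, Multiset.filter_cons_of_neg s (not_le.2 h)]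

lemma countGE_antitone {i j : ℕ} (h : i ≤ j) (s : Multiset ℕ) : countGE j s ≤ countGE i s :=
  Multiset.card_le_card (Multiset.monotone_filter_right s fun _ hx => h.trans hx)

lemma countGE_eq_zero {j : ℕ} {s : Multiset ℕ} : countGE j s = 0 ↔ ∀ x ∈ s, x < j := by
  simp [countGE, Multiset.filter_eq_nil]

lemma countGE_eq_count_add (j : ℕ) (s : Multiset ℕ) :
    countGE j s = s.count j + countGE (j + 1) s := by
  induction s using Multiset.induction_on with
  | empty => rfl
  | cons a s ih =>
    rcases lt_trichotomy a j with h | rfl | h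
    · rw [countGE_cons_of_lt h, countGE_cons_of_lt (by omega), Multiset.count_cons_of_ne h.ne', ih]
    · rw [countGE_cons_of_le le_rfl, countGE_cons_of_lt (by omega), Multiset.count_cons_self, ih]
      ring
    · rw [countGE_cons_of_le h.le, countGE_cons_of_le h, Multiset.count_cons_of_ne h.ne, ih]
      ring

lemma countGE_one {s : Multiset ℕ} (hs : ∀ x ∈ s, 0 < x) : countGE 1 s = s.card := by
  rw [countGE, Multiset.filter_eq_self.2 fun x hx => Nat.succ_le_of_lt (hs x hx)]

lemma mem_of_countGE_pos {j : ℕ} {s : Multiset ℕ} (h : 0 < countGE j s)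
    (hs : ∀ x ∈ s, x ≤ j) : j ∈ s := by
  by_contra hj
  refine h.ne' (countGE_eq_zero.2 fun x hx => ?_)
  exact lt_of_le_of_ne (hs x hx) fun hxj => hj (hxj ▸ hx)

lemma gf_Box_countGE (j : ℕ) : ∀ {k d K : ℕ}, k ≤ K →
    gf (fun s => Box (j + 1 + d) K s ∧ countGE (j + 1) s = k) =
      X ^ ((j + 1) * k) * (gb (k + d) k * gb (j + (K - k)) j)
  | 0, d, K, _ => by
    rw [gf_congr (R := Box j K), gf_Box]
    · simp
    · intro s _
      rw [countGE_eq_zero]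
      refine ⟨fun h => ⟨fun x hx => Nat.lt_succ_iff.1 (h.2 x hx), h.1.2⟩,
        fun h => ⟨⟨fun x hx => ?_, h.2⟩, fun x hx => Nat.lt_succ_iff.2 (h.1 x hx)⟩⟩
      have := h.1 x hx
      omega
  | k + 1, 0, K + 1, hK => by
    rw [gf_congr (R := fun s => j + 1 ∈ s ∧ (Box (j + 1) (K + 1) s ∧ countGE (j + 1) s = k + 1)),
      gf_mem_and (Nat.succ_pos j),
      gf_congr (R := fun s => Box (j + 1 + 0) K s ∧ countGE (j + 1) s = k),
      gf_Box_countGE j (Nat.le_of_succ_le_succ hK)]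
    · simp only [add_zero, gb_self, Nat.succ_eq_add_one, Nat.add_sub_add_right]
      ring
    · intro s _
      simp [Box, countGE_cons_of_le]
    · intro s _
      refine ⟨fun h => ⟨mem_of_countGE_pos (by omega) h.1.1, h⟩, fun h => h.2⟩
  | k + 1, d + 1, K + 1, hK => by
    rw [gf_split _ (fun s => j + 1 + (d + 1) ∈ s),
      gf_congr (Q := fun s => (Box _ _ s ∧ _) ∧ _ ∈ s) fun s _ => and_comm,
      gf_mem_and (show 0 < j + 1 + (d + 1) by omega),
      gf_congr (R := fun s => Box (j + 1 + (d + 1)) K s ∧ countGE (j + 1) s = k),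
      gf_Box_countGE j (Nat.le_of_succ_le_succ hK),
      gf_congr (R := fun s => Box (j + 1 + d) (K + 1) s ∧ countGE (j + 1) s = k + 1),
      gf_Box_countGE j hK, show k + 1 + (d + 1) = k + 1 + d + 1 by ring,
      gb_succ_succ' (show k ≤ k + 1 + d by omega), show k + 1 + d - k = d + 1 by omega,
      show k + (d + 1) = k + 1 + d by ring, Nat.add_sub_add_right]
    · ring
    · intro s _
      refine ⟨fun h => ⟨⟨fun x hx => ?_, h.1.1.2⟩, h.1.2⟩,
        fun h => ⟨⟨⟨fun x hx => (h.1.1 x hx).trans (by omega), h.1.2⟩, h.2⟩, fun hx => ?_⟩⟩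
      · have h1 := h.1.1.1 x hx
        have h2 : x ≠ j + 1 + (d + 1) := fun h' => h.2 (h' ▸ hx)
        omega
      · have := h.1.1 _ hx
        omega
    · intro s _
      rw [countGE_cons_of_le (by omega)]
      simp [Box]

/-- For some `j`, exactly `j + 1 + m` parts are at least `j + 1`. -/
def Hole (m : ℕ) (s : Multiset ℕ) : Prop := ∃ j, countGE (j + 1) s = j + 1 + m

lemma Hole_unique {m i j : ℕ} {s : Multiset ℕ} (hi : countGE (i + 1) s = i + 1 + m)
    (hj : countGE (j + 1) s = j + 1 + m) : i = j := by
  rcases le_total i j with h | h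
  · have := countGE_antitone (Nat.succ_le_succ h) s
    simp only [Nat.succ_eq_add_one] at this
    omega
  · have := countGE_antitone (Nat.succ_le_succ h) s
    simp only [Nat.succ_eq_add_one] at this
    omega

lemma countGE_le_card (j : ℕ) (s : Multiset ℕ) : countGE j s ≤ s.card :=
  Multiset.card_le_card (Multiset.filter_le _ s)

lemma gf_Box_Hole (m M K : ℕ) :
    gf (fun s => Box M (K + m + 1) s ∧ Hole m s) =
      X ^ (m + 1) * B (m + 2) (m + 1) (M + m) K := by
  rw [gf_congr (R := fun s => ∃ j ∈ range (K + 1),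
    Box M (K + m + 1) s ∧ countGE (j + 1) s = j + 1 + m), gf_exists_sum, B, mul_sum]
  · refine sum_congr rfl fun j hj => ?_
    have hj : j ≤ K := Nat.lt_succ_iff.1 (mem_range.1 hj)
    rw [show (j : ℤ) + (m + 1) = (j + 1 + m : ℕ) by push_cast; ring, gz_natCast]
    rcases le_or_gt (j + 1) M with h | h
    · obtain ⟨d, rfl⟩ := Nat.exists_eq_add_of_le h
      rw [gf_Box_countGE j (by omega), show j + (K + m + 1 - (j + 1 + m)) = K by omega,
        show j + 1 + d + m = j + 1 + m + d by ring]
      ring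
    · rw [gb_eq_zero (show M + m < j + 1 + m by omega)]
      simp only [zero_mul, mul_zero]
      refine gf_eq_zero fun s _ hs => ?_
      have : countGE (j + 1) s = 0 :=
        countGE_eq_zero.2 fun x hx => (hs.1.1 x hx).trans_lt h
      omega
  · exact fun s i j hi hj => Hole_unique hi.2 hj.2
  · refine fun s _ => ⟨?_, fun ⟨j, _, h⟩ => ⟨h.1, j, h.2⟩⟩
    rintro ⟨hB, j, hj⟩
    refine ⟨j, mem_range.2 ?_, hB, hj⟩
    have h1 := countGE_le_card (j + 1) s
    have h2 := hB.2
    omega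

lemma X_pow_dvd_gf_Hole_sub {u M K : ℕ} (m : ℕ) (hM : u ≤ M + 1) (hK : u ≤ K + m + 2) :
    X ^ u ∣ gf (Hole m) - X ^ (m + 1) * B (m + 2) (m + 1) (M + m) K := by
  rw [← gf_Box_Hole]
  refine X_pow_dvd_gf_sub fun s hs hu => ⟨fun h => ⟨⟨fun x hx => ?_, ?_⟩, h⟩, fun h => h.2⟩
  · have := le_sum_of_mem hx
    omega
  · have := card_le_sum hs
    omega

lemma gf_Hole (m : ℕ) : gf (Hole m) = X ^ (m + 1) * gf (fun s => ¬ Hole (m + 1) s) := by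
  refine eq_of_forall_X_pow_dvd_sub fun u => ?_
  have h1 := X_pow_dvd_gf_Hole_sub (u := u) (M := u + 1) (K := u) m (by omega) (by omega)
  have h2 := X_pow_dvd_gf_Hole_sub (u := u) (M := u) (K := u) (m + 1) (by omega) (by omega)
  have h3 := X_pow_dvd_gf_true_sub (u := u) (M := u + 1 + m + 1) (K := u)
    (by omega) (by omega)
  have h4 := B_vandermonde (m + 1) (u + 1 + m) (u + 1)
  have h5 := B_inner_right (m + 1) (m + 1) (u + 1 + m) u
  rw [show u + 1 + m + 1 + u = u + 1 + m + (u + 1) by ring,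
    show u + 1 + m + 1 = u + 1 + (m + 1) by ring, ← h4] at h3
  rw [gf_not]
  push_cast at *
  rw [h5] at h3
  convert dvd_sub h1 ((dvd_sub h3 h2).mul_left (X ^ (m + 1))) using 1
  simp only [add_assoc, add_comm 1 m, add_comm 1 (m + 1), Nat.reduceAdd, Int.reduceAdd]
  ring

lemma coeff_nonneg_of_X_pow_dvd_sub {f g : ℤ⟦X⟧} {u n : ℕ} (h : X ^ u ∣ f - g) (hn : n < u)
    (hg : NN g) : 0 ≤ coeff n f := by
  have := X_pow_dvd_iff.1 h n hn
  rw [map_sub, sub_eq_zero] at this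
  exact this ▸ hg n

lemma exists_NN_dvd_sum_E_sub {m n : ℕ} :
    ∃ g, NN g ∧ X ^ (n + 1) ∣ ∑ a ∈ range (n + 2), X ^ (2 * a + 3 + m) * E m a - g := by
  cases m with
  | zero =>
    exact ⟨X ^ 3 * limitE (n + 1), (NN.X_pow _).mul (NN_limitE _),
      dvd_sum_E_zero_sub_limitE (n + 1)⟩
  | succ m =>
    exact ⟨_, NN.sum fun a _ => (NN.X_pow _).mul (NN_E_succ m a),
      by rw [sub_self]; exact dvd_zero _⟩

lemma NN_Bpred (e : ℕ) (c : ℤ) (l r : ℕ) : NN (Bpred e c l r) := by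
  cases r with
  | zero => exact NN.zero
  | succ r => exact NN_B e c l r

lemma coeff_gf_rankGE_succ_le (m n : ℕ) :
    coeff n (gf (RankGE (m + 1))) ≤ coeff n (gf (Hole m)) := by
  obtain ⟨g, hg, hdvd⟩ := exists_NN_dvd_sum_E_sub (m := m) (n := n)
  have h1 := X_pow_dvd_gf_Hole_sub (u := n + 1) (M := n + 2 + 1) (K := n + 2) m
    (by omega) (by omega)
  have h2 := (pow_dvd_pow X (Nat.le_succ (n + 1))).trans (X_pow_dvd_gf_rankGE_sub (m + 1) (n + 2))
  rw [box_identity, sum_congr rfl fun i _ => show (X ^ (i + 2 + m) * gb (2 * i + m + 2) i : ℤ⟦X⟧) =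
    X ^ (i + (m + 1) + 1) * gb (2 * i + (m + 1) + 1) i by
      rw [show i + 2 + m = i + (m + 1) + 1 by ring]; rfl] at h1
  rw [← sub_nonneg, ← map_sub]
  refine coeff_nonneg_of_X_pow_dvd_sub (g := X ^ (m + 1) + X ^ (2 * m + 3 + (n + 2)) *
    Bpred (m + 3) (m + 1) (n + 2 + m) (n + 2) + g) ?_ (Nat.lt_succ_self n)
    (((NN.X_pow _).add ((NN.X_pow _).mul (NN_Bpred _ _ _ _))).add hg)
  convert dvd_add (dvd_sub h1 h2) hdvd using 1
  ring

lemma RankGE_anti {μ ν : ℕ} (h : μ ≤ ν) {s : Multiset ℕ} : RankGE ν s → RankGE μ s :=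
  fun ⟨g, hg, hle, hc⟩ => ⟨g, hg, hle, by omega⟩

lemma coeff_gf_Hole_le (m n : ℕ) : coeff n (gf (Hole m)) ≤ coeff n (gf (RankGE m)) := by
  rw [gf_Hole, gf_rankGE, coeff_X_pow_mul', coeff_X_pow_mul']
  split_ifs with h
  · rw [gf_not, gf_not, map_sub, map_sub]
    have h1 := coeff_gf_rankGE_succ_le (m + 1) (n - (m + 1))
    have h2 := coeff_gf_mono (fun s => RankGE_anti (Nat.le_succ (m + 2)) (s := s)) (n - (m + 1))
    simp only [Nat.succ_eq_add_one, add_assoc, Nat.reduceAdd] at *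
    linarith
  · exact le_rfl

/-- The generating function of the partitions with at least `j + m` parts of size at least `j`. -/
noncomputable def W (m j : ℕ) : ℤ⟦X⟧ := gf fun s => j + m ≤ countGE j s

lemma gf_countGE_eq (m j : ℕ) : gf (fun s => countGE (j + 1) s = j + 1 + m) =
    (1 - X ^ (j + 1)) * (W m (j + 1) - W m (j + 2)) := by
  have hanti := fun s => countGE_antitone (Nat.le_succ (j + 1)) s
  simp only [Nat.succ_eq_add_one, add_assoc, Nat.reduceAdd] at hanti
  have h1 : W m (j + 1) - W m (j + 2) = gf (fun s => j + 1 + m ≤ countGE (j + 1) s ∧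
      ¬ j + 2 + m ≤ countGE (j + 2) s) :=
    gf_sub_of_imp fun s hs => by have := hanti s; omega
  have h2 : gf (fun s => j + 2 + m ≤ countGE (j + 1) s) - W m (j + 2) =
      gf (fun s => j + 2 + m ≤ countGE (j + 1) s ∧ ¬ j + 2 + m ≤ countGE (j + 2) s) :=
    gf_sub_of_imp fun s hs => by have := hanti s; omega
  have h3 : W m (j + 1) - gf (fun s => j + 2 + m ≤ countGE (j + 1) s) =
      gf (fun s => j + 1 + m ≤ countGE (j + 1) s ∧ ¬ j + 2 + m ≤ countGE (j + 1) s) :=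
    gf_sub_of_imp fun s hs => by omega
  have h4 : gf (fun s => j + 2 + m ≤ countGE (j + 1) s ∧ ¬ j + 2 + m ≤ countGE (j + 2) s) =
      X ^ (j + 1) * (W m (j + 1) - W m (j + 2)) := by
    rw [h1, gf_congr (R := fun s => j + 1 ∈ s ∧
      (j + 2 + m ≤ countGE (j + 1) s ∧ ¬ j + 2 + m ≤ countGE (j + 2) s)),
      gf_mem_and (Nat.succ_pos j)]
    · congr 1
      refine gf_congr fun s _ => ?_
      rw [countGE_cons_of_le le_rfl, countGE_cons_of_lt (by omega)]
      omega
    · intro s _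
      refine ⟨fun h => ⟨?_, h⟩, fun h => h.2⟩
      have := countGE_eq_count_add (j + 1) s
      rw [← Multiset.count_pos]
      simp only [add_assoc, Nat.reduceAdd] at *
      omega
  rw [gf_congr (R := fun s => j + 1 + m ≤ countGE (j + 1) s ∧ ¬ j + 2 + m ≤ countGE (j + 1) s)
    fun s _ => by omega]
  linear_combination -h3 - h2 - h4

lemma gf_count_one {Q : Multiset ℕ → Prop} (hQ : ∀ s, Q (1 ::ₘ s) ↔ Q s) (w : ℕ) :
    gf (fun s => s.count 1 = w ∧ Q s) = X ^ w * (1 - X) * gf Q := by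
  induction w with
  | zero =>
    have h := gf_split Q (fun s => 1 ∈ s)
    rw [gf_congr (Q := fun s => Q s ∧ 1 ∈ s) fun s _ => and_comm, gf_mem_and one_pos,
      gf_congr fun s _ => hQ s] at h
    rw [gf_congr (R := fun s => Q s ∧ ¬ 1 ∈ s) fun s _ => by
      rw [Multiset.count_eq_zero, and_comm]]
    linear_combination -h
  | succ w ih =>
    rw [gf_congr (R := fun s => 1 ∈ s ∧ (s.count 1 = w + 1 ∧ Q s)), gf_mem_and one_pos,
      gf_congr (R := fun s => s.count 1 = w ∧ Q s), ih]
    · ring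
    · intro s _
      simp [hQ]
    · intro s _
      refine ⟨fun h => ⟨?_, h⟩, fun h => h.2⟩
      rw [← Multiset.count_pos]
      omega

lemma gf_exists_lt (m : ℕ) : gf (fun s => ∃ g ∈ s, m < g) = W m 1 := by
  have h : gf (fun s => ¬ ∃ g ∈ s, m < g) = gf fun s => ¬ 1 + m ≤ countGE 1 s := by
    refine eq_of_forall_X_pow_dvd_sub fun u => ?_
    have h1 : X ^ u ∣ gf (fun s => ¬ ∃ g ∈ s, m < g) - gf (Box m u) :=
      X_pow_dvd_gf_sub fun s hs hu => by
        have := card_le_sum hs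
        simp only [not_exists, not_and, not_lt, Box]
        exact ⟨fun h => ⟨h, by omega⟩, fun h => h.1⟩
    have h2 : X ^ u ∣ gf (fun s => ¬ 1 + m ≤ countGE 1 s) - gf (Box u m) :=
      X_pow_dvd_gf_sub fun s hs hu => by
        rw [countGE_one hs]
        refine ⟨fun h => ⟨fun x hx => ?_, by omega⟩, fun h => ?_⟩
        · have := le_sum_of_mem hx
          omega
        · have := h.2
          omega
    rw [gf_Box, add_comm, ← gb_symm_add] at h1
    rw [gf_Box] at h2
    convert dvd_sub h1 h2 using 1
    ring
  rw [gf_not, gf_not] at h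
  exact sub_right_injective h

/-- The partitions whose crank exceeds `m`. -/
def CrankGT (m : ℕ) (s : Multiset ℕ) : Prop :=
  (s.count 1 = 0 ∧ ∃ g ∈ s, m < g) ∨
    (0 < s.count 1 ∧ s.count 1 + m + 1 ≤ countGE (s.count 1 + 1) s)

lemma gf_count_one_eq_zero_and (m : ℕ) : gf (fun s => s.count 1 = 0 ∧ ∃ g ∈ s, m < g) =
    (1 - X) * W m 1 - if m = 0 then X else 0 := by
  rw [← gf_exists_lt]
  split_ifs with h
  · subst h
    have h1 := gf_count_one (Q := fun _ => True) (fun _ => Iff.rfl) 0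
    have h2 := gf_split (fun s => s.count 1 = 0 ∧ True) (fun s => s = 0)
    rw [gf_congr (Q := fun s => (s.count 1 = 0 ∧ True) ∧ s = 0) (R := fun s => s = 0)
      fun s _ => ⟨fun h => h.2, by rintro rfl; simp⟩, gf_empty] at h2
    have h3 := gf_split (fun _ => True) (fun s => s = 0)
    rw [gf_congr (Q := fun s => True ∧ s = 0) (R := fun s => s = 0)
      fun s _ => by simp, gf_empty] at h3
    have h4 : ∀ s : Multiset ℕ, (∀ x ∈ s, 0 < x) → (s ≠ 0 ↔ ∃ g ∈ s, 0 < g) := fun s hs =>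
      ⟨fun h => (Multiset.exists_mem_of_ne_zero h).imp fun g hg => ⟨hg, hs g hg⟩,
        by rintro ⟨g, hg, -⟩ rfl; simp at hg⟩
    rw [gf_congr (Q := fun s => s.count 1 = 0 ∧ ∃ g ∈ s, 0 < g)
        (R := fun s => (s.count 1 = 0 ∧ True) ∧ ¬ s = 0) fun s hs => by rw [← h4 s hs]; simp,
      gf_congr (Q := fun s => ∃ g ∈ s, 0 < g) (R := fun s => True ∧ ¬ s = 0)
        fun s hs => by rw [← h4 s hs]; simp]
    rw [pow_zero, one_mul] at h1
    linear_combination h1 - h2 + (1 - X) * h3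
  · rw [gf_count_one (w := 0)]
    · ring
    · intro s
      simp only [Multiset.mem_cons, exists_eq_or_imp]
      exact or_iff_right (by omega)

lemma sum_gf_countGE_eq (m J : ℕ) :
    ∑ j ∈ range J, gf (fun s => countGE (j + 1) s = j + 1 + m) =
      (1 - X) * ∑ j ∈ range J, X ^ j * W m (j + 1) - (1 - X ^ J) * W m (J + 1) := by
  induction J with
  | zero => simp
  | succ J ih =>
    rw [sum_range_succ, sum_range_succ, ih, gf_countGE_eq]
    ring

lemma X_pow_dvd_W (m J : ℕ) : X ^ (J + 1) ∣ W m (J + 1) := by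
  rw [← sub_zero (W m (J + 1)), ← gf_eq_zero (Q := fun _ => False) fun _ _ => id]
  refine X_pow_dvd_gf_sub fun s _ hu => iff_of_false (fun h => ?_) id
  have : countGE (J + 1) s = 0 := countGE_eq_zero.2 fun x hx => (le_sum_of_mem hx).trans_lt hu
  omega

lemma gf_crankGT (m : ℕ) : gf (CrankGT m) + (if m = 0 then X else 0) = gf (Hole m) := by
  refine eq_of_forall_X_pow_dvd_sub fun u => ?_
  have h1 : X ^ u ∣ gf (Hole m) - ∑ j ∈ range u, gf (fun s => countGE (j + 1) s = j + 1 + m) := by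
    rw [← gf_exists_sum _ (fun j s => countGE (j + 1) s = j + 1 + m)
      fun s i j hi hj => Hole_unique hi hj]
    refine X_pow_dvd_gf_sub fun s hs hu => ⟨fun ⟨j, hj⟩ => ⟨j, ?_, hj⟩, fun ⟨j, _, hj⟩ => ⟨j, hj⟩⟩
    have h1 := countGE_le_card (j + 1) s
    have h2 := card_le_sum hs
    rw [mem_range]
    omega
  have h2 : X ^ u ∣ gf (fun s => CrankGT m s ∧ ¬ (s.count 1 = 0 ∧ ∃ g ∈ s, m < g)) -
      ∑ w ∈ range u, gf (fun s => s.count 1 = w + 1 ∧ w + 2 + m ≤ countGE (w + 2) s) := by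
    rw [← gf_exists_sum _ (fun w s => s.count 1 = w + 1 ∧ w + 2 + m ≤ countGE (w + 2) s)
      fun s i j hi hj => by omega]
    refine X_pow_dvd_gf_sub fun s hs hu => ⟨?_, ?_⟩
    · rintro ⟨h | ⟨h3, h4⟩, hn⟩
      · exact absurd h hn
      · obtain ⟨w, hw⟩ := Nat.exists_eq_succ_of_ne_zero h3.ne'
        have h5 := Multiset.count_le_card 1 s
        have h6 := card_le_sum hs
        refine ⟨w, by rw [mem_range]; omega, hw, ?_⟩
        rw [hw] at h4
        simp only [Nat.succ_eq_add_one, add_assoc, Nat.reduceAdd] at *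
        omega
    · rintro ⟨w, -, hw, h3⟩
      refine ⟨Or.inr ⟨by omega, ?_⟩, fun h => by omega⟩
      rw [hw]
      simp only [add_assoc, Nat.reduceAdd] at *
      omega
  have h3 : gf (CrankGT m) = gf (fun s => s.count 1 = 0 ∧ ∃ g ∈ s, m < g) +
      gf (fun s => CrankGT m s ∧ ¬ (s.count 1 = 0 ∧ ∃ g ∈ s, m < g)) := by
    rw [gf_split (CrankGT m) fun s => s.count 1 = 0 ∧ ∃ g ∈ s, m < g]
    congr 1
    exact gf_congr fun s _ => ⟨fun h => h.2, fun h => ⟨Or.inl h, h⟩⟩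
  have h4 : ∑ w ∈ range u, gf (fun s => s.count 1 = w + 1 ∧ w + 2 + m ≤ countGE (w + 2) s) =
      (1 - X) * ∑ w ∈ range u, X ^ (w + 1) * W m (w + 2) := by
    rw [mul_sum]
    refine sum_congr rfl fun w _ => ?_
    rw [gf_count_one, W]
    · ring
    · intro s
      rw [countGE_cons_of_lt (by omega)]
  have h5 : W m 1 + ∑ w ∈ range u, X ^ (w + 1) * W m (w + 2) =
      ∑ j ∈ range u, X ^ j * W m (j + 1) + X ^ u * W m (u + 1) := by
    rw [← sum_range_succ (fun j => X ^ j * W m (j + 1)), sum_range_succ', add_comm]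
    simp
  have h6 := (pow_dvd_pow X (Nat.le_succ u)).trans (X_pow_dvd_W m u)
  rw [sum_gf_countGE_eq] at h1
  rw [h4] at h2
  rw [h3, gf_count_one_eq_zero_and]
  convert dvd_add (dvd_sub h2 h1) (h6.mul_left (1 - X ^ u + (1 - X) * X ^ u)) using 1
  linear_combination (1 - X) * h5

lemma part_one_mem {n : ℕ} (hn : 1 ≤ n) (l : n.Partition) : part l 1 ∈ l.parts ∧
    ∀ x ∈ l.parts, x ≤ part l 1 := by
  have hne : l.parts.sort (· ≤ ·) ≠ [] := by
    intro h
    have h1 := l.parts_sum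
    rw [← Multiset.sort_eq l.parts (· ≤ ·), h] at h1
    simp at h1
    omega
  have hpart : part l 1 = (l.parts.sort (· ≤ ·)).getLast hne := by
    rw [part, List.getD_eq_getElem _ _
      (by simpa only [List.length_reverse] using List.length_pos_iff.2 hne)]
    simp [List.getLast_eq_getElem]
  have hs := Multiset.pairwise_sort l.parts (· ≤ ·)
  rw [hpart]
  refine ⟨(Multiset.mem_sort (· ≤ ·)).1 (List.getLast_mem hne), fun x hx => ?_⟩
  exact hs.rel_getLast ((Multiset.mem_sort (· ≤ ·)).2 hx)

lemma le_rank_iff {n : ℕ} (hn : 1 ≤ n) (l : n.Partition) (μ : ℕ) :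
    (μ : ℤ) ≤ rank l ↔ RankGE μ l.parts := by
  obtain ⟨h1, h2⟩ := part_one_mem hn l
  rw [rank]
  constructor
  · exact fun h => ⟨_, h1, h2, by omega⟩
  · rintro ⟨g, hg, _, h⟩
    have := h2 g hg
    omega

lemma lt_crank_iff {n : ℕ} (hn : 1 ≤ n) (l : n.Partition) (m : ℕ) :
    (m : ℤ) < crank l ↔ CrankGT m l.parts := by
  obtain ⟨h1, h2⟩ := part_one_mem hn l
  rw [crank, CrankGT]
  split_ifs with h
  · simp only [h, true_and, lt_irrefl, false_and, or_false]
    constructor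
    · exact fun h => ⟨_, h1, by omega⟩
    · rintro ⟨g, hg, h⟩
      have := h2 g hg
      omega
  · have h3 : countGE (l.parts.count 1 + 1) l.parts =
      (l.parts.filter fun x => l.parts.count 1 < x).card := rfl
    rw [h3]
    simp only [h, false_and, false_or, Nat.pos_of_ne_zero h, true_and]
    omega

lemma neg_le_rank {n : ℕ} (l : n.Partition) : -(n : ℤ) ≤ rank l := by
  have h := card_le_sum fun x hx => l.parts_pos (i := x) hx
  rw [l.parts_sum] at h
  rw [rank]
  omega

lemma neg_le_crank {n : ℕ} (l : n.Partition) : -(n : ℤ) ≤ crank l := by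
  have h := card_le_sum fun x hx => l.parts_pos (i := x) hx
  rw [l.parts_sum] at h
  have := Multiset.count_le_card 1 l.parts
  rw [crank]
  split_ifs <;> omega

lemma sum_card_fiber_eq {α : Type*} [Fintype α] {f : α → ℤ} {a : ℤ} (hf : ∀ x, a ≤ f x) (b : ℤ) :
    ∑ r ∈ Icc a b, (Nat.card {x // f x = r} : ℤ) =
      ((univ.filter fun x => f x ≤ b).card : ℤ) := by
  classical
  rw [card_eq_sum_card_fiberwise (f := f) (t := Icc a b), Nat.cast_sum]
  · refine sum_congr rfl fun r hr => ?_
    rw [Nat.card_eq_fintype_card, Fintype.card_subtype, filter_filter]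
    congr 2
    ext x
    have := (mem_Icc.1 hr).2
    simp only [mem_filter, mem_univ, true_and]
    omega
  · intro x hx
    simp only [coe_filter, mem_univ, true_and, Set.mem_ofPred_eq, coe_Icc, Set.mem_Icc] at *
    exact ⟨hf x, hx⟩

lemma card_filter_eq_coeff_gf_not {n : ℕ} {f : n.Partition → ℤ} {b : ℤ} {Q : Multiset ℕ → Prop}
    (h : ∀ l, b < f l ↔ Q l.parts) : ((univ.filter fun l => f l ≤ b).card : ℤ) =
      coeff n (gf fun s => ¬ Q s) := by
  classical
  rw [coeff_gf]
  congr 2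
  ext l
  simp [← h]

lemma Nle_eq {n : ℕ} (hn : 1 ≤ n) (m : ℕ) :
    Nle (m : ℤ) n = coeff n (gf fun s => ¬ RankGE (m + 1) s) := by
  rw [Nle]
  simp only [N]
  rw [sum_card_fiber_eq neg_le_rank]
  exact card_filter_eq_coeff_gf_not fun l => by rw [← le_rank_iff hn]; push_cast; rfl

lemma Nle_pred_eq {n : ℕ} (hn : 1 ≤ n) (m : ℕ) :
    Nle ((m : ℤ) - 1) n = coeff n (gf fun s => ¬ RankGE m s) := by
  rw [Nle]
  simp only [N]
  rw [sum_card_fiber_eq neg_le_rank]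
  exact card_filter_eq_coeff_gf_not fun l => by rw [← le_rank_iff hn]; omega

lemma Mle_one (m : ℕ) : Mle (m : ℤ) 1 = if m = 0 then 0 else 1 := by
  simp only [Mle, M, if_true, Nat.cast_one]
  split_ifs with h
  · subst h
    decide
  · rw [← sum_subset (s₁ := Icc (-1) 1) (Icc_subset_Icc le_rfl (by omega))]
    · decide
    · intro r _ hr
      rw [mem_Icc] at hr
      split_ifs <;> omega

lemma coeff_one_gf_crankGT (m : ℕ) : coeff 1 (gf (CrankGT m)) = 0 := by
  rw [coeff_gf_congr (R := fun _ => False), gf_eq_zero fun _ _ => id, map_zero]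
  intro s hs hsum
  rw [iff_false]
  rintro (⟨h, g, hg, -⟩ | ⟨h, h'⟩)
  · have h1 := le_sum_of_mem hg
    have h2 := hs g hg
    obtain rfl : g = 1 := by omega
    exact Multiset.count_eq_zero.1 h hg
  · have h1 := countGE_le_card (s.count 1 + 1) s
    have h2 := card_le_sum hs
    omega

lemma Mle_eq {n : ℕ} (hn : 1 ≤ n) (m : ℕ) :
    Mle (m : ℤ) n = coeff n (gf fun s => ¬ Hole m s) := by
  rw [gf_not, ← gf_crankGT]
  rcases hn.eq_or_lt with rfl | hn'
  · rw [Mle_one, map_sub, map_add, coeff_one_gf_crankGT, coeff_gf]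
    split_ifs <;> simp
  · have h : coeff n (if m = 0 then X else 0 : ℤ⟦X⟧) = 0 := by
      split_ifs
      · rw [coeff_X, if_neg hn'.ne']
      · exact map_zero _
    rw [← sub_sub, map_sub, h, sub_zero, ← gf_not, Mle]
    simp only [M, if_neg hn'.ne']
    rw [sum_card_fiber_eq neg_le_crank]
    exact card_filter_eq_coeff_gf_not fun l => lt_crank_iff hn l m

end QSeries

open RankCrank in
/-- For every integer `m ≥ 0` and every `n ≥ 1`,
`N(≤ m, n) ≥ M(≤ m, n)` and `M(≤ m, n) ≥ N(≤ m-1, n)`. -/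
theorem Mle_le_Nle_and_Nle_pred_le_Mle (m : ℤ) (hm : 0 ≤ m) (n : ℕ) (hn : 1 ≤ n) :
    Mle m n ≤ Nle m n ∧ Nle (m - 1) n ≤ Mle m n := by
  lift m to ℕ using hm
  rw [QSeries.Mle_eq hn, QSeries.Nle_eq hn, QSeries.Nle_pred_eq hn, QSeries.gf_not, QSeries.gf_not,
    QSeries.gf_not]
  simp only [map_sub]
  exact ⟨sub_le_sub_left (QSeries.coeff_gf_rankGE_succ_le m n) _,
    sub_le_sub_left (QSeries.coeff_gf_Hole_le m n) _⟩
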